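/- arXiv:2501.01358 — 2 statements merged into one kernel-verified Lean document; each statement's English description precedes it below -/
import Mathlib

section
/- Let n ≥ 2, α ∈ [0, n) and D > 0. Set s = e^{2n}·D, E = 1 + 4D², and for t ∈ (0, e^{−2n}) let f_β(t) = t·(−log t)^β. Define u_α(x) = f_α(xₙ/s)·(|x′|² − D²) − E·f_{α+1}(xₙ/s) for x = (x′, xₙ) ∈ ℝⁿ with 0 < xₙ < D and |x′| ≤ D. Then for every such x: (a) det D²u_α(x) ≥ 2^{n−2}·s^{−2}·(xₙ/s)^{n−2}·|log(xₙ/s)|^{nα}; (b) the Hessian D²u_α(x) is positive definite, so u_α is convex on the open convex set {x : 0 < xₙ < D, |x′| < D}; and (c) |u_α(x)| ≤ 2E·(xₙ/s)·|log(xₙ/s)|^{α+1}. -/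
open Metric MeasureTheory Real

/-- The Hessian matrix of `u : ℝⁿ → ℝ` at `x`, with entries the second partial
derivatives `∂²u/∂xᵢ∂xⱼ` computed via iterated Fréchet derivatives. -/
noncomputable def hessianMatrix {n : ℕ} (u : EuclideanSpace ℝ (Fin n) → ℝ)
    (x : EuclideanSpace ℝ (Fin n)) : Matrix (Fin n) (Fin n) ℝ :=
  Matrix.of fun i j =>
    fderiv ℝ (fun y => fderiv ℝ u y (EuclideanSpace.single j 1)) x (EuclideanSpace.single i 1)

/-- The determinant of the Hessian matrix, `det D²u(x)`. -/
noncomputable def hessianDet {n : ℕ} (u : EuclideanSpace ℝ (Fin n) → ℝ)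
    (x : EuclideanSpace ℝ (Fin n)) : ℝ := (hessianMatrix u x).det

/-- The determinant of an arrowhead matrix with constant diagonal away from the index `k`. -/
lemma Matrix.det_arrowhead {ι : Type*} [Fintype ι] [DecidableEq ι] (M : Matrix ι ι ℝ) (k : ι)
    {a : ℝ} (ha : a ≠ 0) (b : ι → ℝ)
    (hM : ∀ i j, i ≠ k → j ≠ k → M i j = if i = j then a else 0)
    (hrow : ∀ i, i ≠ k → M k i = b i) (hcol : ∀ i, i ≠ k → M i k = b i) :
    M.det = a ^ (Fintype.card ι - 1) * (M k k - (∑ i ∈ Finset.univ.erase k, b i ^ 2) / a) := by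
  have hA : M.toBlock (· ≠ k) (· ≠ k) = a • (1 : Matrix {i // i ≠ k} {i // i ≠ k} ℝ) := by
    ext i j
    simp [Matrix.toBlock_apply, hM i j i.2 j.2, Matrix.one_apply, Subtype.ext_iff]
  have hcard : Fintype.card {i // i ≠ k} = Fintype.card ι - 1 := by
    simp [Fintype.card_subtype_compl]
  let : Invertible (a • (1 : Matrix {i // i ≠ k} {i // i ≠ k} ℝ)) :=
    ⟨a⁻¹ • 1, by simp [smul_smul, ha], by simp [smul_smul, ha]⟩
  have hinv : ⅟(a • (1 : Matrix {i // i ≠ k} {i // i ≠ k} ℝ)) = a⁻¹ • 1 := rfl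
  let : Unique {i // ¬ i ≠ k} := ⟨⟨⟨k, by simp⟩⟩, fun i => Subtype.ext (not_not.1 i.2)⟩
  have hdef : ((default : {i // ¬ i ≠ k}) : ι) = k := rfl
  rw [M.det_toBlock (· ≠ k), hA, Matrix.det_fromBlocks₁₁, hinv, Matrix.det_smul, Matrix.det_one,
    mul_one, hcard, Matrix.det_unique]
  congr 1
  simp only [Matrix.sub_apply, Matrix.toBlock_apply, hdef, Matrix.mul_smul, Matrix.mul_one,
    Matrix.smul_mul, Matrix.smul_apply, Matrix.mul_apply, smul_eq_mul]
  congr 1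
  rw [div_eq_inv_mul]
  congr 1
  rw [← Finset.sum_subtype (Finset.univ.erase k) (by simp) fun i => M k i * M i k]
  refine Finset.sum_congr rfl fun i hi => ?_
  rw [hrow i (Finset.ne_of_mem_erase hi), hcol i (Finset.ne_of_mem_erase hi), sq]

section AxialFunction

variable {n : ℕ}

/-- The function `x ↦ φ (x k) * (∑_{i ≠ k} x i ^ 2 - c) - ψ (x k)`. -/
def axialFun (k : Fin n) (c : ℝ) (φ ψ : ℝ → ℝ) (x : EuclideanSpace ℝ (Fin n)) : ℝ :=
  φ (x k) * ((∑ i ∈ Finset.univ.erase k, x i ^ 2) - c) - ψ (x k)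

/-- The directional derivative of `axialFun k c φ ψ` along `v`, where `φ'`, `ψ'` are the
derivatives of `φ`, `ψ`. -/
def axialGrad (k : Fin n) (c : ℝ) (φ φ' ψ' : ℝ → ℝ) (v x : EuclideanSpace ℝ (Fin n)) : ℝ :=
  φ' (x k) * v k * ((∑ i ∈ Finset.univ.erase k, x i ^ 2) - c) +
    φ (x k) * (∑ i ∈ Finset.univ.erase k, 2 * x i * v i) - ψ' (x k) * v k

/-- The second derivative of `axialFun k c φ ψ` at `x` along `v` and `w`. -/
def axialHess (k : Fin n) (c : ℝ) (φ φ' φ'' ψ'' : ℝ → ℝ) (x v w : EuclideanSpace ℝ (Fin n)) : ℝ :=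
  (φ'' (x k) * ((∑ i ∈ Finset.univ.erase k, x i ^ 2) - c) - ψ'' (x k)) * (v k * w k) +
    φ' (x k) * (v k * (∑ i ∈ Finset.univ.erase k, 2 * x i * w i) +
      w k * (∑ i ∈ Finset.univ.erase k, 2 * x i * v i)) +
    φ (x k) * (∑ i ∈ Finset.univ.erase k, 2 * v i * w i)

lemma hasFDerivAt_coord (k : Fin n) (x : EuclideanSpace ℝ (Fin n)) :
    HasFDerivAt (fun y : EuclideanSpace ℝ (Fin n) => y k)
      (EuclideanSpace.proj k : EuclideanSpace ℝ (Fin n) →L[ℝ] ℝ) x :=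
  (EuclideanSpace.proj k : EuclideanSpace ℝ (Fin n) →L[ℝ] ℝ).hasFDerivAt

lemma hasFDerivAt_sum_sq (S : Finset (Fin n)) (x : EuclideanSpace ℝ (Fin n)) :
    HasFDerivAt (fun y : EuclideanSpace ℝ (Fin n) => ∑ i ∈ S, y i ^ 2)
      (∑ i ∈ S, (2 * x i) • (EuclideanSpace.proj i : EuclideanSpace ℝ (Fin n) →L[ℝ] ℝ)) x := by
  refine HasFDerivAt.fun_sum fun i _ => ?_
  simpa using (hasFDerivAt_coord i x).pow 2

lemma hasFDerivAt_sum_mul (S : Finset (Fin n)) (x v : EuclideanSpace ℝ (Fin n)) :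
    HasFDerivAt (fun y : EuclideanSpace ℝ (Fin n) => ∑ i ∈ S, 2 * y i * v i)
      (∑ i ∈ S, (2 * v i) • (EuclideanSpace.proj i : EuclideanSpace ℝ (Fin n) →L[ℝ] ℝ)) x := by
  refine HasFDerivAt.fun_sum fun i _ => ?_
  refine (((hasFDerivAt_coord i x).const_mul 2).mul_const (v i)).congr_fderiv ?_
  rw [smul_smul, mul_comm]

lemma exists_hasFDerivAt_axialFun (k : Fin n) (c : ℝ) {φ φ' ψ ψ' : ℝ → ℝ}
    {x : EuclideanSpace ℝ (Fin n)} (hφ : HasDerivAt φ (φ' (x k)) (x k))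
    (hψ : HasDerivAt ψ (ψ' (x k)) (x k)) :
    ∃ L : EuclideanSpace ℝ (Fin n) →L[ℝ] ℝ, HasFDerivAt (axialFun k c φ ψ) L x ∧
      ∀ v, L v = axialGrad k c φ φ' ψ' v x := by
  refine ⟨_, ((hφ.comp_hasFDerivAt x (hasFDerivAt_coord k x)).mul
    ((hasFDerivAt_sum_sq (Finset.univ.erase k) x).sub_const c)).sub
    (hψ.comp_hasFDerivAt x (hasFDerivAt_coord k x)), fun v => ?_⟩
  simp [axialGrad]
  ring

lemma exists_hasFDerivAt_axialGrad (k : Fin n) (c : ℝ) {φ φ' φ'' ψ' ψ'' : ℝ → ℝ}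
    {x : EuclideanSpace ℝ (Fin n)} (hφ : HasDerivAt φ (φ' (x k)) (x k))
    (hφ' : HasDerivAt φ' (φ'' (x k)) (x k)) (hψ' : HasDerivAt ψ' (ψ'' (x k)) (x k))
    (v : EuclideanSpace ℝ (Fin n)) :
    ∃ L : EuclideanSpace ℝ (Fin n) →L[ℝ] ℝ, HasFDerivAt (axialGrad k c φ φ' ψ' v) L x ∧
      ∀ w, L w = axialHess k c φ φ' φ'' ψ'' x v w := by
  refine ⟨_, ((((hφ'.comp_hasFDerivAt x (hasFDerivAt_coord k x)).mul_const (v k)).mul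
    ((hasFDerivAt_sum_sq (Finset.univ.erase k) x).sub_const c)).add
    ((hφ.comp_hasFDerivAt x (hasFDerivAt_coord k x)).mul
      (hasFDerivAt_sum_mul (Finset.univ.erase k) x v))).sub
    ((hψ'.comp_hasFDerivAt x (hasFDerivAt_coord k x)).mul_const (v k)), fun w => ?_⟩
  simp [axialHess]
  ring

/-- The Hessian matrix of `axialFun`, for profiles that are twice differentiable on `I`. -/
lemma hessianMatrix_axialFun {k : Fin n} {c : ℝ} {φ φ' φ'' ψ ψ' ψ'' : ℝ → ℝ} {I : Set ℝ}
    (hI : IsOpen I) (hφ : ∀ t ∈ I, HasDerivAt φ (φ' t) t) (hφ' : ∀ t ∈ I, HasDerivAt φ' (φ'' t) t)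
    (hψ : ∀ t ∈ I, HasDerivAt ψ (ψ' t) t) (hψ' : ∀ t ∈ I, HasDerivAt ψ' (ψ'' t) t)
    {x : EuclideanSpace ℝ (Fin n)} (hx : x k ∈ I) (i j : Fin n) :
    hessianMatrix (axialFun k c φ ψ) x i j =
      axialHess k c φ φ' φ'' ψ'' x (EuclideanSpace.single j 1) (EuclideanSpace.single i 1) := by
  have hev : (fun y => fderiv ℝ (axialFun k c φ ψ) y (EuclideanSpace.single j 1)) =ᶠ[nhds x]
      axialGrad k c φ φ' ψ' (EuclideanSpace.single j 1) := by
    have hc : ContinuousAt (fun y : EuclideanSpace ℝ (Fin n) => y k) x :=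
      (hasFDerivAt_coord k x).continuousAt
    filter_upwards [hc.preimage_mem_nhds (hI.mem_nhds hx)] with y hy
    obtain ⟨L, hL, hLv⟩ := exists_hasFDerivAt_axialFun k c (hφ _ hy) (hψ _ hy)
    rw [hL.fderiv, hLv]
  obtain ⟨L, hL, hLw⟩ := exists_hasFDerivAt_axialGrad k c (hφ _ hx) (hφ' _ hx) (hψ' _ hx)
    (EuclideanSpace.single j (1 : ℝ))
  rw [hessianMatrix, Matrix.of_apply, hev.fderiv_eq, hL.fderiv, hLw]

/-- A function `axialFun` with nonnegative second derivatives is convex. -/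
lemma convexOn_axialFun {k : Fin n} {c : ℝ} {φ φ' φ'' ψ ψ' ψ'' : ℝ → ℝ} {I : Set ℝ}
    (hφ : ∀ t ∈ I, HasDerivAt φ (φ' t) t) (hφ' : ∀ t ∈ I, HasDerivAt φ' (φ'' t) t)
    (hψ : ∀ t ∈ I, HasDerivAt ψ (ψ' t) t) (hψ' : ∀ t ∈ I, HasDerivAt ψ' (ψ'' t) t)
    {U : Set (EuclideanSpace ℝ (Fin n))} (hU : Convex ℝ U) (hUI : ∀ x ∈ U, x k ∈ I)
    (hnonneg : ∀ x ∈ U, ∀ v, 0 ≤ axialHess k c φ φ' φ'' ψ'' x v v) :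
    ConvexOn ℝ U (axialFun k c φ ψ) := by
  refine ⟨hU, fun x hx y hy a b ha hb hab => ?_⟩
  have hline : ∀ τ : ℝ, HasDerivAt (fun τ : ℝ => x + τ • (y - x)) (y - x) τ := fun τ => by
    simpa using ((hasDerivAt_id τ).smul_const (y - x)).const_add x
  have hmem : ∀ τ ∈ Set.Icc (0 : ℝ) 1, x + τ • (y - x) ∈ U := fun τ hτ =>
    hU.add_smul_sub_mem hx hy hτ
  have h1 : ∀ τ ∈ Set.Icc (0 : ℝ) 1, HasDerivAt (fun τ : ℝ => axialFun k c φ ψ (x + τ • (y - x)))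
      (axialGrad k c φ φ' ψ' (y - x) (x + τ • (y - x))) τ := fun τ hτ => by
    have hI := hUI _ (hmem τ hτ)
    obtain ⟨L, hL, hLv⟩ := exists_hasFDerivAt_axialFun k c (hφ _ hI) (hψ _ hI)
    rw [← hLv]
    exact hL.comp_hasDerivAt τ (hline τ)
  have h2 : ∀ τ ∈ Set.Icc (0 : ℝ) 1,
      HasDerivAt (fun τ : ℝ => axialGrad k c φ φ' ψ' (y - x) (x + τ • (y - x)))
      (axialHess k c φ φ' φ'' ψ'' (x + τ • (y - x)) (y - x) (y - x)) τ := fun τ hτ => by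
    have hI := hUI _ (hmem τ hτ)
    obtain ⟨L, hL, hLv⟩ := exists_hasFDerivAt_axialGrad k c (hφ _ hI) (hφ' _ hI) (hψ' _ hI) (y - x)
    rw [← hLv]
    exact hL.comp_hasDerivAt τ (hline τ)
  have hconv := convexOn_of_hasDerivWithinAt2_nonneg (convex_Icc (0 : ℝ) 1)
    (fun τ hτ => (h1 τ hτ).continuousAt.continuousWithinAt)
    (fun τ hτ => (h1 τ (interior_subset hτ)).hasDerivWithinAt)
    (fun τ hτ => (h2 τ (interior_subset hτ)).hasDerivWithinAt)
    (fun τ hτ => hnonneg _ (hmem τ (interior_subset hτ)) _)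
  have key := hconv.2 (Set.left_mem_Icc.2 zero_le_one) (Set.right_mem_Icc.2 zero_le_one) ha hb hab
  have hab' : x + b • (y - x) = a • x + b • y := by
    obtain rfl : a = 1 - b := by linarith
    module
  simpa [hab'] using key

lemma axialHess_comm (k : Fin n) (c : ℝ) (φ φ' φ'' ψ'' : ℝ → ℝ)
    (x v w : EuclideanSpace ℝ (Fin n)) :
    axialHess k c φ φ' φ'' ψ'' x v w = axialHess k c φ φ' φ'' ψ'' x w v := by
  have h : ∑ i ∈ Finset.univ.erase k, 2 * v i * w i = ∑ i ∈ Finset.univ.erase k, 2 * w i * v i :=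
    Finset.sum_congr rfl fun i _ => by ring
  rw [axialHess, axialHess, h]
  ring

lemma isLinearMap_axialHess (k : Fin n) (c : ℝ) (φ φ' φ'' ψ'' : ℝ → ℝ)
    (x v : EuclideanSpace ℝ (Fin n)) : IsLinearMap ℝ (axialHess k c φ φ' φ'' ψ'' x v) where
  map_add w w' := by
    simp only [axialHess, PiLp.add_apply, mul_add, Finset.sum_add_distrib]
    ring
  map_smul r w := by
    have h : ∀ u : Fin n → ℝ, ∑ i ∈ Finset.univ.erase k, 2 * u i * (r * w i) =
        r * ∑ i ∈ Finset.univ.erase k, 2 * u i * w i := fun u => by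
      rw [Finset.mul_sum]
      exact Finset.sum_congr rfl fun i _ => by ring
    simp only [axialHess, PiLp.smul_apply, smul_eq_mul, h]
    ring

lemma axialHess_eq_sum (k : Fin n) (c : ℝ) (φ φ' φ'' ψ'' : ℝ → ℝ)
    (x v w : EuclideanSpace ℝ (Fin n)) :
    axialHess k c φ φ' φ'' ψ'' x v w =
      ∑ i, w i * axialHess k c φ φ' φ'' ψ'' x v (EuclideanSpace.single i 1) := by
  have h := map_sum (isLinearMap_axialHess k c φ φ' φ'' ψ'' x v).mk'
    (fun i => w i • EuclideanSpace.single i (1 : ℝ)) Finset.univ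
  have hw : ∑ i, w i • EuclideanSpace.single i (1 : ℝ) = w := by
    simpa using (EuclideanSpace.basisFun (Fin n) ℝ).sum_repr w
  rw [hw] at h
  simpa using h

lemma axialHess_self_pos {k : Fin n} {c : ℝ} {φ φ' φ'' ψ'' : ℝ → ℝ}
    {x v : EuclideanSpace ℝ (Fin n)} (hφ : 0 < φ (x k))
    (h : 2 * φ' (x k) ^ 2 * (∑ i ∈ Finset.univ.erase k, x i ^ 2) <
      φ (x k) * (φ'' (x k) * ((∑ i ∈ Finset.univ.erase k, x i ^ 2) - c) - ψ'' (x k)))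
    (hv : v ≠ 0) : 0 < axialHess k c φ φ' φ'' ψ'' x v v := by
  have hxv : ∑ i ∈ Finset.univ.erase k, 2 * x i * v i =
      2 * ∑ i ∈ Finset.univ.erase k, x i * v i := by
    rw [Finset.mul_sum]
    exact Finset.sum_congr rfl fun i _ => by ring
  have hvv : ∑ i ∈ Finset.univ.erase k, 2 * v i * v i =
      2 * ∑ i ∈ Finset.univ.erase k, v i ^ 2 := by
    rw [Finset.mul_sum]
    exact Finset.sum_congr rfl fun i _ => by ring
  have hsq : ∑ i ∈ Finset.univ.erase k, (φ (x k) * v i + φ' (x k) * v k * x i) ^ 2 =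
      φ (x k) ^ 2 * (∑ i ∈ Finset.univ.erase k, v i ^ 2) +
      2 * φ (x k) * φ' (x k) * v k * (∑ i ∈ Finset.univ.erase k, x i * v i) +
      (φ' (x k) * v k) ^ 2 * (∑ i ∈ Finset.univ.erase k, x i ^ 2) := by
    simp only [Finset.mul_sum, ← Finset.sum_add_distrib]
    exact Finset.sum_congr rfl fun i _ => by ring
  have hsq0 : 0 ≤ ∑ i ∈ Finset.univ.erase k, (φ (x k) * v i + φ' (x k) * v k * x i) ^ 2 :=
    Finset.sum_nonneg fun i _ => sq_nonneg _
  rw [axialHess, hxv, hvv]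
  rcases eq_or_ne (v k) 0 with hk | hk
  · have hS : 0 < ∑ i ∈ Finset.univ.erase k, v i ^ 2 := by
      obtain ⟨i, hi⟩ : ∃ i, v i ≠ 0 := by
        by_contra! h0
        exact hv (by ext i; simpa using h0 i)
      exact Finset.sum_pos' (fun i _ => sq_nonneg _)
        ⟨i, by simp; rintro rfl; exact hi hk, by positivity⟩
    simp only [hk]
    nlinarith [mul_pos hφ hS]
  · have hk2 : 0 < v k ^ 2 := by positivity
    refine (mul_pos_iff_of_pos_left hφ).1 ?_
    nlinarith [mul_pos hk2 (sub_pos.2 h)]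

/-- Positive definiteness of a matrix representing the quadratic form `axialHess`. -/
lemma posDef_of_axialHess {k : Fin n} {c : ℝ} {φ φ' φ'' ψ'' : ℝ → ℝ}
    {x : EuclideanSpace ℝ (Fin n)} {M : Matrix (Fin n) (Fin n) ℝ}
    (hM : ∀ i j, M i j =
      axialHess k c φ φ' φ'' ψ'' x (EuclideanSpace.single j 1) (EuclideanSpace.single i 1))
    (hpos : ∀ v, v ≠ 0 → 0 < axialHess k c φ φ' φ'' ψ'' x v v) : M.PosDef := by
  refine Matrix.posDef_iff_dotProduct_mulVec.2 ⟨?_, fun z hz => ?_⟩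
  · ext i j
    simp [hM, axialHess_comm k c φ φ' φ'' ψ'' x (EuclideanSpace.single i 1)]
  · have h := hpos (WithLp.toLp 2 z) (by simpa using hz)
    rw [axialHess_eq_sum] at h
    refine h.trans_eq (Finset.sum_congr rfl fun i _ => ?_)
    rw [axialHess_comm, axialHess_eq_sum]
    simp [Matrix.mulVec, dotProduct, hM, mul_comm,
      axialHess_comm k c φ φ' φ'' ψ'' x (EuclideanSpace.single i 1)]

lemma det_of_axialHess {k : Fin n} {c : ℝ} {φ φ' φ'' ψ'' : ℝ → ℝ}
    {x : EuclideanSpace ℝ (Fin n)} {M : Matrix (Fin n) (Fin n) ℝ}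
    (hM : ∀ i j, M i j =
      axialHess k c φ φ' φ'' ψ'' x (EuclideanSpace.single j 1) (EuclideanSpace.single i 1))
    (hφ : φ (x k) ≠ 0) :
    M.det = (2 * φ (x k)) ^ (n - 1) *
      (φ'' (x k) * ((∑ i ∈ Finset.univ.erase k, x i ^ 2) - c) - ψ'' (x k) -
        (∑ i ∈ Finset.univ.erase k, (2 * φ' (x k) * x i) ^ 2) / (2 * φ (x k))) := by
  have hkk : M k k = φ'' (x k) * ((∑ i ∈ Finset.univ.erase k, x i ^ 2) - c) - ψ'' (x k) := by
    have h1 : ∀ u : Fin n → ℝ, ∑ i ∈ Finset.univ.erase k,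
        u i * (EuclideanSpace.single k (1 : ℝ) : EuclideanSpace ℝ (Fin n)) i = 0 := fun u =>
      Finset.sum_eq_zero fun i hi => by simp [Finset.ne_of_mem_erase hi]
    simp only [hM, axialHess, h1]
    simp
  have hik : ∀ i, i ≠ k → M i k = 2 * φ' (x k) * x i := fun i hi => by
    simp [hM, axialHess, hi, hi.symm]
    ring
  have hki : ∀ i, i ≠ k → M k i = M i k := fun i _ => by rw [hM, hM, axialHess_comm]
  have h := M.det_arrowhead k (mul_ne_zero two_ne_zero hφ) (fun i => 2 * φ' (x k) * x i)
    (fun i j hi hj => ?_) (fun i hi => (hki i hi).trans (hik i hi)) hik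
  · rw [h, hkk, Fintype.card_fin]
  · simp [hM, axialHess, hi, hj, hi.symm, hj.symm]
    split_ifs <;> ring

end AxialFunction

section LogProfile

/-- The profile `y ↦ (y / s) * (-log (y / s)) ^ β`. -/
noncomputable def logProfile (s β y : ℝ) : ℝ := y / s * (-log (y / s)) ^ β

/-- The first derivative of `logProfile s β`. -/
noncomputable def logProfileDeriv (s β y : ℝ) : ℝ :=
  1 / s * ((-log (y / s)) ^ β * (1 - β / -log (y / s)))

/-- The second derivative of `logProfile s β`. -/
noncomputable def logProfileDeriv2 (s β y : ℝ) : ℝ :=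
  -(β / (s * y)) * ((-log (y / s)) ^ β / -log (y / s)) * (1 - (β - 1) / -log (y / s))

lemma neg_log_div_pos {s y : ℝ} (hy : y ∈ Set.Ioo 0 s) : 0 < -log (y / s) := by
  have hs : 0 < s := hy.1.trans hy.2
  exact neg_pos.2 (log_neg (div_pos hy.1 hs) ((div_lt_one hs).2 hy.2))

lemma hasDerivAt_neg_log_div {s y : ℝ} (hy : y ∈ Set.Ioo 0 s) :
    HasDerivAt (fun y => -log (y / s)) (-(1 / y)) y := by
  have hs : 0 < s := hy.1.trans hy.2
  have hy0 := hy.1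
  refine (((hasDerivAt_id y).div_const s).log (div_pos hy.1 hs).ne').neg.congr_deriv ?_
  simp only [id]
  field_simp

lemma hasDerivAt_neg_log_div_rpow {s y : ℝ} (β : ℝ) (hy : y ∈ Set.Ioo 0 s) :
    HasDerivAt (fun y => (-log (y / s)) ^ β)
      (-(1 / y) * β * ((-log (y / s)) ^ β / -log (y / s))) y := by
  have hL := neg_log_div_pos hy
  refine ((hasDerivAt_neg_log_div hy).rpow_const (p := β) (Or.inl hL.ne')).congr_deriv ?_
  rw [rpow_sub_one hL.ne']

lemma hasDerivAt_logProfile {s y : ℝ} (β : ℝ) (hy : y ∈ Set.Ioo 0 s) :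
    HasDerivAt (logProfile s β) (logProfileDeriv s β y) y := by
  have hs : 0 < s := hy.1.trans hy.2
  have hy0 := hy.1
  have hL := neg_log_div_pos hy
  refine (((hasDerivAt_id y).div_const s).mul (hasDerivAt_neg_log_div_rpow β hy)).congr_deriv ?_
  rw [logProfileDeriv]
  generalize -log (y / s) = L at *
  simp only [id]
  field_simp
  ring

lemma hasDerivAt_logProfileDeriv {s y : ℝ} (β : ℝ) (hy : y ∈ Set.Ioo 0 s) :
    HasDerivAt (logProfileDeriv s β) (logProfileDeriv2 s β y) y := by
  have hs : 0 < s := hy.1.trans hy.2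
  have hy0 := hy.1
  have hL := neg_log_div_pos hy
  refine (((hasDerivAt_neg_log_div_rpow β hy).mul
    (((hasDerivAt_const y β).div (hasDerivAt_neg_log_div hy) hL.ne').const_sub 1)).const_mul
      (1 / s)).congr_deriv ?_
  simp only [logProfileDeriv2, Pi.div_apply]
  generalize -log (y / s) = L at *
  field_simp
  ring

lemma logProfile_pos {s y : ℝ} (β : ℝ) (hy : y ∈ Set.Ioo 0 s) : 0 < logProfile s β y :=
  mul_pos (div_pos hy.1 (hy.1.trans hy.2)) (rpow_pos_of_pos (neg_log_div_pos hy) β)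

/-- The Schur complement estimate for the Hessian of the subsolution. -/
lemma schur_complement_logProfile {s y α D E q : ℝ} (hy : y ∈ Set.Ioo 0 s) (hα : 0 ≤ α)
    (hL : 2 * α ≤ -log (y / s)) (hE : E = 1 + 4 * D ^ 2) (hq : q ≤ D ^ 2) (hq0 : 0 ≤ q) :
    2 * logProfileDeriv s α y ^ 2 * q + ((-log (y / s)) ^ α) ^ 2 / (2 * s ^ 2) ≤
      logProfile s α y *
        (logProfileDeriv2 s α y * (q - D ^ 2) - E * logProfileDeriv2 s (α + 1) y) := by
  have hs : 0 < s := hy.1.trans hy.2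
  have hy0 := hy.1
  have hL0 := neg_log_div_pos hy
  simp only [logProfile, logProfileDeriv, logProfileDeriv2, rpow_add_one hL0.ne']
  generalize -log (y / s) = L at *
  have hP : 0 < L ^ α := rpow_pos_of_pos hL0 α
  generalize L ^ α = P at *
  obtain ⟨l, hl⟩ : ∃ l, l = α / L := ⟨_, rfl⟩
  have hl0 : 0 ≤ l := hl ▸ by positivity
  have hl2 : l ≤ 1 / 2 := by rw [hl, div_le_div_iff₀ hL0 two_pos]; linarith
  have hlhs : 2 * (1 / s * (P * (1 - α / L))) ^ 2 * q + P ^ 2 / (2 * s ^ 2) =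
      P ^ 2 / s ^ 2 * (2 * (1 - l) ^ 2 * q + 1 / 2) := by
    rw [hl]; field_simp
  have hrhs : y / s * P * (-(α / (s * y)) * (P / L) * (1 - (α - 1) / L) * (q - D ^ 2) -
      E * (-((α + 1) / (s * y)) * (P * L / L) * (1 - (α + 1 - 1) / L))) =
      P ^ 2 / s ^ 2 * (l * (1 - l + 1 / L) * (D ^ 2 - q) + E * (α + 1) * (1 - l)) := by
    rw [hl]; field_simp; ring
  rw [hlhs, hrhs]
  refine mul_le_mul_of_nonneg_left ?_ (by positivity)
  have h1 : 0 ≤ l * (1 - l + 1 / L) * (D ^ 2 - q) := by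
    have : 0 ≤ 1 / L := by positivity
    exact mul_nonneg (mul_nonneg hl0 (by linarith)) (by linarith)
  have hE1 : 0 < E := by rw [hE]; positivity
  have h2 : E * (1 / 2) ≤ E * (α + 1) * (1 - l) := by
    rw [mul_assoc]
    exact mul_le_mul_of_nonneg_left (by nlinarith) hE1.le
  have h3 : (1 - l) ^ 2 * q ≤ q := mul_le_of_le_one_left hq0 (by nlinarith)
  linarith

lemma abs_logProfile_combination_le {s y α D E q : ℝ} (hy : y ∈ Set.Ioo 0 s)
    (hL : 1 ≤ -log (y / s)) (hE : E = 1 + 4 * D ^ 2) (hq : q ≤ D ^ 2) (hq0 : 0 ≤ q) :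
    |logProfile s α y * (q - D ^ 2) - E * logProfile s (α + 1) y| ≤
      2 * E * (y / s) * |log (y / s)| ^ (α + 1) := by
  have hL0 := neg_log_div_pos hy
  have hf := logProfile_pos α hy
  have hmul : logProfile s (α + 1) y = logProfile s α y * -log (y / s) := by
    rw [logProfile, logProfile, rpow_add_one hL0.ne', mul_assoc]
  have hle : logProfile s α y ≤ logProfile s (α + 1) y := by
    rw [hmul]
    exact le_mul_of_one_le_right hf.le hL
  have hrhs : 2 * E * (y / s) * |log (y / s)| ^ (α + 1) = 2 * E * logProfile s (α + 1) y := by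
    rw [abs_of_neg (neg_pos.1 hL0), logProfile, mul_assoc]
  have hDE : D ^ 2 ≤ E := by rw [hE]; nlinarith [sq_nonneg D]
  have hE0 : 0 < E := by rw [hE]; positivity
  rw [hrhs, abs_le]
  constructor <;> nlinarith [mul_nonneg hf.le hq0, mul_nonneg hf.le (sub_nonneg.2 hq),
    mul_le_mul hDE hle hf.le hE0.le, mul_pos hE0 (hf.trans_le hle)]

end LogProfile

lemma convex_sqrt_sum_sq_lt {ι : Type*} [Fintype ι] (S : Finset ι) {D : ℝ} (hD : 0 < D) :
    Convex ℝ {x : EuclideanSpace ℝ ι | √(∑ i ∈ S, x i ^ 2) < D} := by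
  have h : ConvexOn ℝ Set.univ (fun x : EuclideanSpace ℝ ι => ∑ i ∈ S, x i ^ 2) := by
    classical
    induction S using Finset.induction_on with
    | empty => simpa using convexOn_const (0 : ℝ) convex_univ
    | insert i S hi ih =>
      simp only [Finset.sum_insert hi]
      exact ((even_two.convexOn_pow (𝕜 := ℝ)).comp_linearMap
        (EuclideanSpace.proj i : EuclideanSpace ℝ ι →L[ℝ] ℝ).toLinearMap).add ih
  simpa [sqrt_lt' hD] using h.convex_lt (D ^ 2)

/-- The inequality `-log (y / s) > 2 a` for `s = exp (2 a) * D` and `0 < y < D`. -/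
lemma two_mul_lt_neg_log_div {a y D : ℝ} (hy : 0 < y) (hyD : y < D) :
    2 * a < -log (y / (exp (2 * a) * D)) := by
  have hD := hy.trans hyD
  rw [lt_neg, log_lt_iff_lt_exp (by positivity), exp_neg, div_lt_iff₀ (by positivity),
    inv_mul_cancel_left₀ (exp_pos _).ne']
  exact hyD

/-- The family of subsolutions
`u_α(x) = f_α(xₙ/s)(|x'|² - D²) - E f_{α+1}(xₙ/s)` with `f_β(t) = t(-log t)^β`:
Hessian determinant lower bound, positive definiteness/convexity, and size bound. -/
theorem stmt_16 (n : ℕ) (hn : 2 ≤ n) (α D : ℝ)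
    (hα0 : 0 ≤ α) (hαn : α < (n : ℝ)) (hD : 0 < D)
    (s E : ℝ) (hs : s = Real.exp (2 * n) * D) (hE : E = 1 + 4 * D ^ 2)
    (uα : EuclideanSpace ℝ (Fin n) → ℝ)
    (huα : uα = fun x =>
      (x ⟨n - 1, by omega⟩ / s) * (-Real.log (x ⟨n - 1, by omega⟩ / s)) ^ α *
        ((∑ i ∈ Finset.univ.erase (⟨n - 1, by omega⟩ : Fin n), x i ^ 2) - D ^ 2) -
      E * ((x ⟨n - 1, by omega⟩ / s) * (-Real.log (x ⟨n - 1, by omega⟩ / s)) ^ (α + 1))) :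
    (∀ x : EuclideanSpace ℝ (Fin n), 0 < x ⟨n - 1, by omega⟩ → x ⟨n - 1, by omega⟩ < D →
      Real.sqrt (∑ i ∈ Finset.univ.erase (⟨n - 1, by omega⟩ : Fin n), x i ^ 2) ≤ D →
      hessianDet uα x ≥ (2 : ℝ) ^ (n - 2) / s ^ 2 * (x ⟨n - 1, by omega⟩ / s) ^ (n - 2) *
          |Real.log (x ⟨n - 1, by omega⟩ / s)| ^ ((n : ℝ) * α) ∧
      (hessianMatrix uα x).PosDef ∧
      |uα x| ≤ 2 * E * (x ⟨n - 1, by omega⟩ / s) *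
          |Real.log (x ⟨n - 1, by omega⟩ / s)| ^ (α + 1)) ∧
    ConvexOn ℝ {x : EuclideanSpace ℝ (Fin n) | 0 < x ⟨n - 1, by omega⟩ ∧
      x ⟨n - 1, by omega⟩ < D ∧
      Real.sqrt (∑ i ∈ Finset.univ.erase (⟨n - 1, by omega⟩ : Fin n), x i ^ 2) < D} uα := by
  have hn1 : (2 : ℝ) ≤ n := by exact_mod_cast hn
  set k : Fin n := ⟨n - 1, by omega⟩
  have hs0 : 0 < s := by rw [hs]; positivity
  have hDs : D < s := by
    rw [hs]
    exact lt_mul_of_one_lt_left hD (one_lt_exp_iff.2 (by positivity))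
  have hu : uα = axialFun k (D ^ 2) (logProfile s α) (fun y => E * logProfile s (α + 1) y) := huα
  have hφ : ∀ t ∈ Set.Ioo 0 s, HasDerivAt (logProfile s α) (logProfileDeriv s α t) t :=
    fun t ht => hasDerivAt_logProfile α ht
  have hφ' : ∀ t ∈ Set.Ioo 0 s, HasDerivAt (logProfileDeriv s α) (logProfileDeriv2 s α t) t :=
    fun t ht => hasDerivAt_logProfileDeriv α ht
  have hψ : ∀ t ∈ Set.Ioo 0 s, HasDerivAt (fun y => E * logProfile s (α + 1) y)
      ((fun y => E * logProfileDeriv s (α + 1) y) t) t :=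
    fun t ht => (hasDerivAt_logProfile (α + 1) ht).const_mul E
  have hψ' : ∀ t ∈ Set.Ioo 0 s, HasDerivAt (fun y => E * logProfileDeriv s (α + 1) y)
      ((fun y => E * logProfileDeriv2 s (α + 1) y) t) t :=
    fun t ht => (hasDerivAt_logProfileDeriv (α + 1) ht).const_mul E
  have hmem : ∀ x : EuclideanSpace ℝ (Fin n), 0 < x k → x k < D → x k ∈ Set.Ioo 0 s :=
    fun x h0 h1 => ⟨h0, h1.trans hDs⟩
  have hlog : ∀ x : EuclideanSpace ℝ (Fin n), 0 < x k → x k < D → 2 * (n : ℝ) < -log (x k / s) :=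
    fun x h0 h1 => hs ▸ two_mul_lt_neg_log_div h0 h1
  have hq0 : ∀ x : EuclideanSpace ℝ (Fin n), 0 ≤ ∑ i ∈ Finset.univ.erase k, x i ^ 2 :=
    fun x => Finset.sum_nonneg fun i _ => sq_nonneg _
  have hschur : ∀ x : EuclideanSpace ℝ (Fin n), 0 < x k → x k < D →
      √(∑ i ∈ Finset.univ.erase k, x i ^ 2) ≤ D → _ := fun x h0 h1 h2 =>
    schur_complement_logProfile (hmem x h0 h1) hα0 (by linarith [hlog x h0 h1]) hE
      ((sqrt_le_left hD.le).1 h2) (hq0 x)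
  have hpos : ∀ x : EuclideanSpace ℝ (Fin n), 0 < x k → x k < D →
      √(∑ i ∈ Finset.univ.erase k, x i ^ 2) ≤ D → ∀ v, v ≠ 0 →
      0 < axialHess k (D ^ 2) (logProfile s α) (logProfileDeriv s α) (logProfileDeriv2 s α)
        (fun y => E * logProfileDeriv2 s (α + 1) y) x v v := fun x h0 h1 h2 v hv => by
    have hP : 0 < (-log (x k / s)) ^ α := rpow_pos_of_pos (neg_log_div_pos (hmem x h0 h1)) α
    refine axialHess_self_pos (logProfile_pos α (hmem x h0 h1)) ?_ hv
    exact (lt_add_of_pos_right _ (by positivity)).trans_le (hschur x h0 h1 h2)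
  refine ⟨fun x h0 h1 h2 => ⟨?_, ?_, ?_⟩, ?_⟩
  · have hM := hessianMatrix_axialFun (c := D ^ 2) isOpen_Ioo hφ hφ' hψ hψ' (hmem x h0 h1)
    have hf := logProfile_pos α (hmem x h0 h1)
    have hL := neg_log_div_pos (hmem x h0 h1)
    have hP : 0 < (-log (x k / s)) ^ α := rpow_pos_of_pos hL α
    have hS := hschur x h0 h1 h2
    have hpow : |log (x k / s)| ^ ((n : ℝ) * α) = ((-log (x k / s)) ^ α) ^ n := by
      rw [abs_of_neg (neg_pos.1 hL), mul_comm, rpow_mul hL.le, rpow_natCast]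
    have hsum : ∑ i ∈ Finset.univ.erase k, (2 * logProfileDeriv s α (x k) * x i) ^ 2 =
        4 * logProfileDeriv s α (x k) ^ 2 * ∑ i ∈ Finset.univ.erase k, x i ^ 2 := by
      rw [Finset.mul_sum]
      exact Finset.sum_congr rfl fun i _ => by ring
    have hn' : n = n - 2 + 2 := by omega
    rw [hu, hessianDet, det_of_axialHess hM hf.ne', hsum, hpow, ge_iff_le]
    have hlow : (2 : ℝ) ^ (n - 2) / s ^ 2 * (x k / s) ^ (n - 2) * ((-log (x k / s)) ^ α) ^ n =
        (2 * logProfile s α (x k)) ^ (n - 2) *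
          (2 * (((-log (x k / s)) ^ α) ^ 2 / (2 * s ^ 2))) := by
      have : ((-log (x k / s)) ^ α) ^ n =
          ((-log (x k / s)) ^ α) ^ (n - 2) * ((-log (x k / s)) ^ α) ^ 2 := by
        rw [← pow_add, ← hn']
      rw [this, logProfile, mul_pow, mul_pow]
      field_simp
    rw [hlow, show n - 1 = n - 2 + 1 by omega, pow_succ (2 * logProfile s α (x k)), mul_assoc]
    refine mul_le_mul_of_nonneg_left ?_ (by positivity)
    rw [mul_sub, mul_div_cancel₀ _ (by positivity)]
    linarith
  · rw [hu]
    exact posDef_of_axialHess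
      (hessianMatrix_axialFun (c := D ^ 2) isOpen_Ioo hφ hφ' hψ hψ' (hmem x h0 h1))
      (hpos x h0 h1 h2)
  · rw [hu]
    exact abs_logProfile_combination_le (hmem x h0 h1) (by linarith [hlog x h0 h1]) hE
      ((sqrt_le_left hD.le).1 h2) (hq0 x)
  · rw [hu]
    refine convexOn_axialFun hφ hφ' hψ hψ' ?_ (fun x hx => hmem x hx.1 hx.2.1)
      fun x hx v => ?_
    · have hk : IsLinearMap ℝ (fun x : EuclideanSpace ℝ (Fin n) => x k) :=
        (EuclideanSpace.proj k : EuclideanSpace ℝ (Fin n) →L[ℝ] ℝ).toLinearMap.isLinear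
      exact (convex_halfSpace_gt hk 0).inter
        ((convex_halfSpace_lt hk D).inter (convex_sqrt_sum_sq_lt _ hD))
    · rcases eq_or_ne v 0 with rfl | hv
      · simp [axialHess]
      · exact (hpos x hx.1 hx.2.1 hx.2.2.le v hv).le
end

section
/- Let n ≥ 2, p > n − 2, M > 0, V > 0 and D > 0. There exists a constant C > 0 depending only on n, p, M, V, D such that the following holds: for every bounded open convex set Ω ⊂ ℝⁿ with |Ω| = V and diam(Ω) = D, and every nonzero convex function u continuous on the closure of Ω, continuously differentiable in Ω and twice continuously differentiable in Ω, satisfying det D²u(x) = M·|u(x)|^p for all x ∈ Ω and u = 0 on ∂Ω, the gradient of u is bounded on Ω with sup_{x ∈ Ω} |Du(x)| ≤ C · sup_{Ω} |u|. -/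
open Metric MeasureTheory Real

lemma Matrix.IsHermitian.eigenvalues_eq_dotProduct {n : ℕ} {H : Matrix (Fin n) (Fin n) ℝ}
    (hH : H.IsHermitian) (i : Fin n) :
    ∃ v : Fin n → ℝ, v ⬝ᵥ v = 1 ∧ hH.eigenvalues i = v ⬝ᵥ (H.mulVec v) := by
  refine ⟨WithLp.ofLp (hH.eigenvectorBasis i), ?_, ?_⟩
  · have h := hH.eigenvectorBasis.orthonormal.1 i
    have h2 : inner ℝ (hH.eigenvectorBasis i) (hH.eigenvectorBasis i) = (1 : ℝ) := by
      rw [real_inner_self_eq_norm_sq, h, one_pow]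
    rw [EuclideanSpace.inner_eq_star_dotProduct] at h2
    simpa using h2
  · simpa using hH.eigenvalues_eq i

lemma Matrix.pow_le_det_of_le_quadForm {n : ℕ} {H : Matrix (Fin n) (Fin n) ℝ}
    (hH : H.IsHermitian) {c : ℝ} (hc : 0 ≤ c)
    (h : ∀ v : Fin n → ℝ, c * (v ⬝ᵥ v) ≤ v ⬝ᵥ (H.mulVec v)) : c ^ n ≤ H.det := by
  rw [hH.det_eq_prod_eigenvalues]
  have : ∏ _i : Fin n, c ≤ ∏ i, hH.eigenvalues i := by
    refine Finset.prod_le_prod (fun _ _ => hc) fun i _ => ?_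
    obtain ⟨v, hv, he⟩ := hH.eigenvalues_eq_dotProduct i
    rw [he]; simpa [hv] using h v
  simpa using this

lemma Matrix.det_le_pow_of_quadForm_le {n : ℕ} {H : Matrix (Fin n) (Fin n) ℝ}
    (hH : H.IsHermitian) {c : ℝ} (h0 : ∀ v : Fin n → ℝ, 0 ≤ v ⬝ᵥ (H.mulVec v))
    (h : ∀ v : Fin n → ℝ, v ⬝ᵥ (H.mulVec v) ≤ c * (v ⬝ᵥ v)) : H.det ≤ c ^ n := by
  rw [hH.det_eq_prod_eigenvalues]
  have : ∏ i, hH.eigenvalues i ≤ ∏ _i : Fin n, c := by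
    refine Finset.prod_le_prod (fun i _ => ?_) fun i _ => ?_
    · obtain ⟨v, hv, he⟩ := hH.eigenvalues_eq_dotProduct i
      rw [he]; exact h0 v
    · obtain ⟨v, hv, he⟩ := hH.eigenvalues_eq_dotProduct i
      rw [he]; simpa [hv] using h v
  simpa using this

lemma Matrix.det_ge_of_rankOne_le_quadForm {n : ℕ} {H : Matrix (Fin n) (Fin n) ℝ}
    (hH : H.IsHermitian) {e : Fin n → ℝ} (he : e ⬝ᵥ e = 1) {a k : ℝ} (ha : 0 ≤ a) (hk : 0 ≤ k)
    (h : ∀ v : Fin n → ℝ, a * (v ⬝ᵥ v + k * (e ⬝ᵥ v) ^ 2) ≤ v ⬝ᵥ (H.mulVec v)) :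
    a ^ n * (1 + k) ≤ H.det := by
  obtain ⟨κ, hκ⟩ : ∃ κ : ℝ, (1 + κ) ^ 2 * (1 + k) = 1 := by
    refine ⟨(√(1 + k))⁻¹ - 1, ?_⟩
    have : (0 : ℝ) < 1 + k := by positivity
    rw [add_sub_cancel, inv_pow, Real.sq_sqrt this.le, inv_mul_cancel₀ this.ne']
  set R : Matrix (Fin n) (Fin n) ℝ := 1 + Matrix.vecMulVec (κ • e) e with hR
  have hRT : R.transpose = R := by
    simp [hR, Matrix.transpose_vecMulVec, Matrix.smul_vecMulVec]
  have hRv : ∀ v, R.mulVec v = v + (κ * (e ⬝ᵥ v)) • e := by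
    intro v
    simp [hR, Matrix.add_mulVec, Matrix.smul_vecMulVec, Matrix.smul_mulVec,
      Matrix.vecMulVec_mulVec, smul_smul]
  have hdet : R.det = 1 + κ := by
    rw [hR, Matrix.vecMulVec_eq Unit, Matrix.det_one_add_replicateCol_mul_replicateRow]
    simp [he]
  have hRH : (R * H * R).IsHermitian := by
    have := Matrix.isHermitian_conjTranspose_mul_mul R hH
    rwa [Matrix.conjTranspose_eq_transpose_of_trivial, hRT] at this
  have key := Matrix.pow_le_det_of_le_quadForm hRH ha (fun v => by
    have h1 : v ⬝ᵥ ((R * H * R).mulVec v) = (R.mulVec v) ⬝ᵥ (H.mulVec (R.mulVec v)) := by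
      rw [← Matrix.mulVec_mulVec, ← Matrix.mulVec_mulVec, Matrix.dotProduct_mulVec,
        ← Matrix.mulVec_transpose, hRT]
    rw [h1]
    refine le_trans (le_of_eq ?_) (h (R.mulVec v))
    rw [hRv]
    simp only [add_dotProduct, dotProduct_add, smul_dotProduct, dotProduct_smul, he, smul_eq_mul]
    rw [dotProduct_comm v e]
    linear_combination (-a * (e ⬝ᵥ v) ^ 2) * hκ)
  rw [Matrix.det_mul, Matrix.det_mul, hdet] at key
  calc a ^ n * (1 + k) ≤ ((1 + κ) * H.det * (1 + κ)) * (1 + k) := by gcongr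
    _ = H.det := by linear_combination H.det * hκ

lemma IsLocalMin.second_deriv_nonneg {g g' : ℝ → ℝ} {x c : ℝ} (hmin : IsLocalMin g x)
    (hg : ∀ᶠ r in nhds x, HasDerivAt g (g' r) r) (hg' : HasDerivAt g' c x) : 0 ≤ c := by
  by_contra! hc
  have hd : deriv g =ᶠ[nhds x] g' := hg.mono fun r hr => hr.deriv
  have hdd : deriv (deriv g) x = c := by rw [hd.deriv_eq, hg'.deriv]
  have hmax : IsLocalMax g x := isLocalMax_of_deriv_deriv_neg (by rwa [hdd]) hmin.deriv_eq_zero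
    hg.self_of_nhds.continuousAt
  have hconst : g =ᶠ[nhds x] fun _ => g x := by
    filter_upwards [hmin, hmax] with r h1 h2 using le_antisymm h2 h1
  have : deriv (deriv g) x = 0 := by
    rw [hconst.deriv.deriv_eq]; simp
  linarith

section Hessian

variable {n : ℕ} {u : EuclideanSpace ℝ (Fin n) → ℝ} {Ω : Set (EuclideanSpace ℝ (Fin n))}
  {x : EuclideanSpace ℝ (Fin n)}

lemma ContDiffOn.differentiableAt_fderiv (hΩ : IsOpen Ω) (hu : ContDiffOn ℝ 2 u Ω) (hx : x ∈ Ω) :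
    DifferentiableAt ℝ (fderiv ℝ u) x :=
  ((hu.fderiv_of_isOpen hΩ (m := 1) (by norm_num)).differentiableOn (by norm_num)).differentiableAt
    (hΩ.mem_nhds hx)

lemma hessianMatrix_apply (hu : DifferentiableAt ℝ (fderiv ℝ u) x) (i j : Fin n) :
    hessianMatrix u x i j =
      fderiv ℝ (fderiv ℝ u) x (EuclideanSpace.single i 1) (EuclideanSpace.single j 1) := by
  simp only [hessianMatrix, Matrix.of_apply]
  rw [fderiv_clm_apply hu (by fun_prop)]
  simp

lemma hessianMatrix_isHermitian (hΩ : IsOpen Ω) (hu : ContDiffOn ℝ 2 u Ω) (hx : x ∈ Ω) :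
    (hessianMatrix u x).IsHermitian := by
  have hd := hu.differentiableAt_fderiv hΩ hx
  have hs : IsSymmSndFDerivAt ℝ u x :=
    (hu.contDiffAt (hΩ.mem_nhds hx)).isSymmSndFDerivAt (by simp)
  ext i j
  simp only [Matrix.conjTranspose_apply, star_trivial]
  rw [hessianMatrix_apply hd, hessianMatrix_apply hd]
  exact hs.eq _ _

lemma hessianMatrix_quadForm (hu : DifferentiableAt ℝ (fderiv ℝ u) x) (v : Fin n → ℝ) :
    v ⬝ᵥ ((hessianMatrix u x).mulVec v) =
      fderiv ℝ (fderiv ℝ u) x (WithLp.toLp 2 v) (WithLp.toLp 2 v) := by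
  have hv : WithLp.toLp 2 v = ∑ i, v i • EuclideanSpace.single i (1 : ℝ) := by
    ext j
    simp [Finset.sum_apply, Pi.single_apply]
  rw [hv]
  simp only [map_sum, map_smul, sum_apply, smul_apply,
    dotProduct, Matrix.mulVec, hessianMatrix_apply hu, smul_eq_mul, Finset.mul_sum]
  rw [Finset.sum_comm]
  refine Finset.sum_congr rfl fun i _ => Finset.sum_congr rfl fun j _ => ?_
  ring

lemma eventually_hasDerivAt_line (hΩ : IsOpen Ω) (hu : ContDiffOn ℝ 2 u Ω) (hx : x ∈ Ω)
    (v : EuclideanSpace ℝ (Fin n)) :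
    ∀ᶠ r : ℝ in nhds 0, HasDerivAt (fun r : ℝ => u (x + r • v)) (fderiv ℝ u (x + r • v) v) r := by
  have hc : ContinuousAt (fun r : ℝ => x + r • v) 0 := by fun_prop
  have hΩ' : Ω ∈ nhds (x + (0 : ℝ) • v) := by simpa using hΩ.mem_nhds hx
  filter_upwards [hc.preimage_mem_nhds hΩ'] with r hr
  have h1 : DifferentiableAt ℝ u (x + r • v) :=
    (hu.differentiableOn (by norm_num)).differentiableAt (hΩ.mem_nhds hr)
  have h2 : HasDerivAt (fun r : ℝ => x + r • v) v r := by
    simpa using ((hasDerivAt_id r).smul_const v).const_add x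
  exact h1.hasFDerivAt.comp_hasDerivAt r h2

lemma hasDerivAt_fderiv_line (hu : DifferentiableAt ℝ (fderiv ℝ u) x)
    (v : EuclideanSpace ℝ (Fin n)) :
    HasDerivAt (fun r : ℝ => fderiv ℝ u (x + r • v) v) (fderiv ℝ (fderiv ℝ u) x v v) 0 := by
  have h2 : HasDerivAt (fun r : ℝ => x + r • v) v 0 := by
    simpa using ((hasDerivAt_id (0 : ℝ)).smul_const v).const_add x
  have h3 : HasFDerivAt (fderiv ℝ u) (fderiv ℝ (fderiv ℝ u) x) (x + (0 : ℝ) • v) := by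
    simpa using hu.hasFDerivAt
  have h4 := h3.comp_hasDerivAt (0 : ℝ) h2
  simpa using h4.clm_apply (hasDerivAt_const (0 : ℝ) v)

lemma le_second_fderiv_of_touching_below (hΩ : IsOpen Ω) (hu : ContDiffOn ℝ 2 u Ω) (hx : x ∈ Ω)
    {v : EuclideanSpace ℝ (Fin n)} {f f' : ℝ → ℝ} {c : ℝ}
    (hf : ∀ᶠ r in nhds 0, HasDerivAt f (f' r) r) (hf' : HasDerivAt f' c 0)
    (hmin : IsLocalMin (fun r : ℝ => u (x + r • v) - f r) 0) :
    c ≤ fderiv ℝ (fderiv ℝ u) x v v := by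
  have h := hmin.second_deriv_nonneg
    (((eventually_hasDerivAt_line hΩ hu hx v).and hf).mono fun r hr => hr.1.sub hr.2)
    ((hasDerivAt_fderiv_line (hu.differentiableAt_fderiv hΩ hx) v).sub hf')
  linarith

lemma second_fderiv_le_of_touching_above (hΩ : IsOpen Ω) (hu : ContDiffOn ℝ 2 u Ω) (hx : x ∈ Ω)
    {v : EuclideanSpace ℝ (Fin n)} {f f' : ℝ → ℝ} {c : ℝ}
    (hf : ∀ᶠ r in nhds 0, HasDerivAt f (f' r) r) (hf' : HasDerivAt f' c 0)
    (hmax : IsLocalMax (fun r : ℝ => u (x + r • v) - f r) 0) :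
    fderiv ℝ (fderiv ℝ u) x v v ≤ c := by
  have h := IsLocalMin.second_deriv_nonneg (g := fun r => f r - u (x + r • v))
    (by simpa using hmax.neg)
    (((eventually_hasDerivAt_line hΩ hu hx v).and hf).mono fun r hr => hr.2.sub hr.1)
    (hf'.sub (hasDerivAt_fderiv_line (hu.differentiableAt_fderiv hΩ hx) v))
  linarith

lemma ConvexOn.fderiv_apply_sub_le (hc : ConvexOn ℝ Ω u) (hd : DifferentiableAt ℝ u x)
    (hx : x ∈ Ω) {y : EuclideanSpace ℝ (Fin n)} (hy : y ∈ Ω) :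
    fderiv ℝ u x (y - x) ≤ u y - u x := by
  have hl : HasDerivAt (fun r : ℝ => u (x + r • (y - x))) (fderiv ℝ u x (y - x)) 0 := by
    have h2 : HasDerivAt (fun r : ℝ => x + r • (y - x)) (y - x) 0 := by
      simpa using ((hasDerivAt_id (0 : ℝ)).smul_const (y - x)).const_add x
    have h3 : HasFDerivAt u (fderiv ℝ u x) (x + (0 : ℝ) • (y - x)) := by
      simpa using hd.hasFDerivAt
    exact h3.comp_hasDerivAt (0 : ℝ) h2
  have hcx : ConvexOn ℝ (Set.Icc (0 : ℝ) 1) (fun r : ℝ => u (x + r • (y - x))) := by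
    have := hc.comp_affineMap (AffineMap.lineMap (k := ℝ) x y)
    refine (this.subset ?_ (convex_Icc _ _)).congr fun r _ => ?_
    · intro r hr
      exact hc.1.lineMap_mem hx hy hr
    · simp [AffineMap.lineMap_apply, add_comm]
  have := hcx.le_slope_of_hasDerivAt (x := 0) (y := 1) (by simp) (by simp) (by norm_num) hl
  simpa [slope_def_field] using this

lemma ConvexOn.second_fderiv_nonneg (hΩ : IsOpen Ω) (hu : ContDiffOn ℝ 2 u Ω)
    (hc : ConvexOn ℝ Ω u) (hx : x ∈ Ω) (v : EuclideanSpace ℝ (Fin n)) :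
    0 ≤ fderiv ℝ (fderiv ℝ u) x v v := by
  refine le_second_fderiv_of_touching_below hΩ hu hx (f := fun r => u x + r * fderiv ℝ u x v)
    (f' := fun _ => fderiv ℝ u x v) (.of_forall fun r => ?_) (hasDerivAt_const _ _) ?_
  · simpa using ((hasDerivAt_id r).mul_const (fderiv ℝ u x v)).const_add (u x)
  · have hcont : ContinuousAt (fun r : ℝ => x + r • v) 0 := by fun_prop
    have hΩ' : Ω ∈ nhds (x + (0 : ℝ) • v) := by simpa using hΩ.mem_nhds hx
    filter_upwards [hcont.preimage_mem_nhds hΩ'] with r hr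
    have := hc.fderiv_apply_sub_le ((hu.differentiableOn (by norm_num)).differentiableAt
      (hΩ.mem_nhds hx)) hx hr
    simp only [add_sub_cancel_left, map_smul, smul_eq_mul] at this
    simp only [zero_smul, add_zero, zero_mul, sub_self]
    linarith

end Hessian

section Barrier

variable {n : ℕ}

/-- For `1 < γ` and suitable `N`, `C`, this is a strictly convex function, negative but bounded
below by a multiple of the height `⟪e, x - z⟫ + δ`, on bounded parts of a half-space. -/
noncomputable def halfSpaceBarrier (e z : EuclideanSpace ℝ (Fin n)) (δ γ N C : ℝ)
    (x : EuclideanSpace ℝ (Fin n)) : ℝ :=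
  (inner ℝ e (x - z) + δ) ^ γ * (‖x - z‖ ^ 2 + N) - C * (inner ℝ e (x - z) + δ)

lemma exists_second_deriv_rpow_mul_quadratic {t τ a b c N C γ R : ℝ} (ht : 0 < t) (hγ : 1 < γ)
    (ha : 0 ≤ a) (hc : 0 ≤ c) (hb : b ^ 2 ≤ R ^ 2 * c)
    (hN : γ * (γ - 1) * N = 4 * γ ^ 2 * R ^ 2 + 1) :
    ∃ (f' : ℝ → ℝ) (d : ℝ),
      (∀ᶠ r in nhds 0, HasDerivAt
        (fun r : ℝ => (t + r * τ) ^ γ * (a + 2 * b * r + c * r ^ 2 + N) - C * (t + r * τ))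
        (f' r) r) ∧
      HasDerivAt f' d 0 ∧ t ^ γ * (c + (t ^ 2)⁻¹ * τ ^ 2) ≤ d := by
  have hl : ∀ r : ℝ, HasDerivAt (fun r : ℝ => t + r * τ) τ r := fun r => by
    simpa using ((hasDerivAt_id r).mul_const τ).const_add t
  have hq : ∀ r : ℝ, HasDerivAt (fun r : ℝ => a + 2 * b * r + c * r ^ 2 + N)
      (2 * b + 2 * c * r) r := fun r => by
    have h1 := (((hasDerivAt_id r).const_mul (2 * b)).const_add a).add
      ((hasDerivAt_pow 2 r).const_mul c)
    refine (h1.add_const N).congr_deriv ?_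
    simp; ring
  have hq' : ∀ r : ℝ, HasDerivAt (fun r : ℝ => 2 * b + 2 * c * r) (2 * c) r := fun r => by
    simpa using ((hasDerivAt_id r).const_mul (2 * c)).const_add (2 * b)
  refine ⟨fun r => τ * γ * (t + r * τ) ^ (γ - 1) * (a + 2 * b * r + c * r ^ 2 + N)
      + (t + r * τ) ^ γ * (2 * b + 2 * c * r) - C * τ,
    (τ * γ * (τ * (γ - 1) * t ^ (γ - 2))) * (a + N) + τ * γ * t ^ (γ - 1) * (2 * b)
      + (τ * γ * t ^ (γ - 1) * (2 * b) + t ^ γ * (2 * c)), ?_, ?_, ?_⟩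
  · have hcont : ContinuousAt (fun r : ℝ => t + r * τ) 0 := by fun_prop
    have hpos : ∀ᶠ r : ℝ in nhds 0, 0 < t + r * τ :=
      hcont.eventually_const_lt (by simpa using ht)
    filter_upwards [hpos] with r hr
    have h1 := (hl r).rpow_const (p := γ) (Or.inl hr.ne')
    exact ((h1.mul (hq r)).sub ((hl r).const_mul C))
  · have h0 : t + 0 * τ ≠ 0 := by simpa using ht.ne'
    have h1 := (hl 0).rpow_const (p := γ - 1) (Or.inl h0)
    have h2 := (hl 0).rpow_const (p := γ) (Or.inl h0)
    have h3 := (((h1.const_mul (τ * γ)).mul (hq 0)).add (h2.mul (hq' 0))).sub_const (C * τ)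
    refine h3.congr_deriv ?_
    have : γ - 1 - 1 = γ - 2 := by ring
    simp [this]
  · have e1 : t ^ (γ - 1) = t ^ γ / t := by rw [rpow_sub ht, rpow_one]
    have e2 : t ^ (γ - 2) = t ^ γ / t ^ 2 := by
      rw [rpow_sub ht]; norm_num
    rw [e1, e2]
    have hP : 0 < t ^ γ := rpow_pos_of_pos ht γ
    set σ := τ / t with hσ
    have hτ : τ = σ * t := by rw [hσ]; field_simp
    have key : c + σ ^ 2 ≤ γ * (γ - 1) * σ ^ 2 * (a + N) + 4 * γ * σ * b + 2 * c := by
      have h1 : 0 ≤ γ * (γ - 1) * σ ^ 2 * a := by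
        have : 0 < γ - 1 := by linarith
        positivity
      have h2 : γ * (γ - 1) * σ ^ 2 * N = (4 * γ ^ 2 * R ^ 2 + 1) * σ ^ 2 := by
        rw [← hN]; ring
      have h3 : (4 * γ * σ * b) ^ 2 ≤ (4 * γ ^ 2 * R ^ 2 * σ ^ 2 + c) ^ 2 := by
        have : (4 * γ * σ * b) ^ 2 ≤ (4 * γ * σ) ^ 2 * (R ^ 2 * c) := by
          rw [mul_pow]; gcongr
        nlinarith [sq_nonneg (4 * γ ^ 2 * R ^ 2 * σ ^ 2 - c)]
      have h4 := abs_le_of_sq_le_sq' h3 (by positivity)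
      nlinarith [h4.1]
    calc t ^ γ * (c + (t ^ 2)⁻¹ * τ ^ 2) = t ^ γ * (c + σ ^ 2) := by
          rw [hτ]; field_simp
      _ ≤ t ^ γ * (γ * (γ - 1) * σ ^ 2 * (a + N) + 4 * γ * σ * b + 2 * c) := by gcongr
      _ = _ := by rw [hτ]; field_simp; ring

lemma exists_second_deriv_halfSpaceBarrier {e z x : EuclideanSpace ℝ (Fin n)} {δ γ N C R : ℝ}
    (hγ : 1 < γ) (hN : γ * (γ - 1) * N = 4 * γ ^ 2 * R ^ 2 + 1) (hx : ‖x - z‖ ≤ R)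
    (ht : 0 < inner ℝ e (x - z) + δ) (v : EuclideanSpace ℝ (Fin n)) :
    ∃ (f' : ℝ → ℝ) (d : ℝ),
      (∀ᶠ r in nhds 0, HasDerivAt
        (fun r : ℝ => halfSpaceBarrier e z δ γ N C (x + r • v)) (f' r) r) ∧
      HasDerivAt f' d 0 ∧
      (inner ℝ e (x - z) + δ) ^ γ *
        (‖v‖ ^ 2 + ((inner ℝ e (x - z) + δ) ^ 2)⁻¹ * inner ℝ e v ^ 2) ≤ d := by
  have hfun : (fun r : ℝ => halfSpaceBarrier e z δ γ N C (x + r • v)) = fun r : ℝ =>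
      ((inner ℝ e (x - z) + δ) + r * inner ℝ e v) ^ γ *
        (‖x - z‖ ^ 2 + 2 * inner ℝ (x - z) v * r + ‖v‖ ^ 2 * r ^ 2 + N)
        - C * ((inner ℝ e (x - z) + δ) + r * inner ℝ e v) := by
    funext r
    have h1 : x + r • v - z = (x - z) + r • v := by abel
    have h2 : inner ℝ e (x + r • v - z) + δ = (inner ℝ e (x - z) + δ) + r * inner ℝ e v := by
      rw [h1, inner_add_right, real_inner_smul_right]; ring
    have h3 : ‖x + r • v - z‖ ^ 2 = ‖x - z‖ ^ 2 + 2 * inner ℝ (x - z) v * r + ‖v‖ ^ 2 * r ^ 2 := by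
      rw [h1, norm_add_sq_real, real_inner_smul_right, norm_smul, mul_pow, Real.norm_eq_abs, sq_abs]
      ring
    rw [halfSpaceBarrier, h2, h3]
  rw [hfun]
  refine exists_second_deriv_rpow_mul_quadratic ht hγ (sq_nonneg _) (sq_nonneg _) ?_ hN
  calc inner ℝ (x - z) v ^ 2 = |inner ℝ (x - z) v| ^ 2 := (sq_abs _).symm
    _ ≤ (‖x - z‖ * ‖v‖) ^ 2 := by gcongr; exact abs_real_inner_le_norm _ _
    _ ≤ (R * ‖v‖) ^ 2 := by gcongr
    _ = _ := by ring

end Barrier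

section Estimates

variable {n : ℕ} {u : EuclideanSpace ℝ (Fin n) → ℝ} {Ω : Set (EuclideanSpace ℝ (Fin n))}

lemma abs_le_mul_height_of_hessianDet_le (hΩ : IsOpen Ω) (hb : Bornology.IsBounded Ω)
    (huc : ContinuousOn u (closure Ω)) (hu : ContDiffOn ℝ 2 u Ω)
    (hu0 : ∀ x ∈ frontier Ω, u x = 0) (hneg : ∀ x ∈ Ω, u x ≤ 0)
    {z e : EuclideanSpace ℝ (Fin n)} (he : ‖e‖ = 1) {D : ℝ} (hD : 0 < D)
    (hze : ∀ x ∈ closure Ω, 0 ≤ inner ℝ e (x - z)) (hzD : ∀ x ∈ closure Ω, ‖x - z‖ ≤ D)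
    {q γ N C K m δ : ℝ} (hqn : q < n) (hγ : 1 < γ) (hγq : γ * n = q + 2)
    (hN : γ * (γ - 1) * N = 4 * γ ^ 2 * D ^ 2 + 1) (hC : C = (2 * D) ^ (γ - 1) * (D ^ 2 + N) + 1)
    (hK : 0 ≤ K) (hm : 0 < m)
    (hdet : ∀ x ∈ Ω, hessianDet u x ≤ K * m ^ (n - q) * |u x| ^ q)
    (hq : 0 < q) (hδ : 0 < δ) (hδD : δ ≤ D) {x : EuclideanSpace ℝ (Fin n)} (hx : x ∈ Ω) :
    |u x| ≤ m * (K * C ^ q) ^ ((n - q)⁻¹) * C * (inner ℝ e (x - z) + δ) := by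
  have hN0 : 0 < N := by
    have h1 : 0 < γ * (γ - 1) := by nlinarith
    have h2 : 0 < γ * (γ - 1) * N := by rw [hN]; positivity
    exact (pos_iff_pos_of_mul_pos h2).1 h1
  have hC0 : 0 < C := by rw [hC]; positivity
  set w := halfSpaceBarrier e z δ γ N C with hw
  have hwx : ∀ y ∈ closure Ω, w y < 0 ∧ |w y| ≤ C * (inner ℝ e (y - z) + δ) := by
    intro y hy
    have h1 := hze y hy
    have h2 := hzD y hy
    have h3 : inner ℝ e (y - z) ≤ D := by
      calc inner ℝ e (y - z) ≤ ‖e‖ * ‖y - z‖ := real_inner_le_norm _ _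
        _ ≤ D := by rw [he, one_mul]; exact h2
    set t := inner ℝ e (y - z) + δ with ht
    have ht0 : 0 < t := by linarith
    have h4 : t ^ γ = t * t ^ (γ - 1) := by
      rw [rpow_sub_one ht0.ne']; field_simp
    have h5 : t ^ (γ - 1) * (‖y - z‖ ^ 2 + N) ≤ (2 * D) ^ (γ - 1) * (D ^ 2 + N) := by
      gcongr
      linarith
    have h6 : 0 ≤ t ^ γ * (‖y - z‖ ^ 2 + N) := by positivity
    have h7 : w y = t ^ γ * (‖y - z‖ ^ 2 + N) - C * t := rfl
    have h8 : w y < 0 := by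
      rw [h7, h4, hC]
      nlinarith
    refine ⟨h8, ?_⟩
    rw [abs_of_neg h8, h7]
    linarith
  have hwc : ContinuousOn w (closure Ω) := by
    rw [hw]
    unfold halfSpaceBarrier
    refine ContinuousOn.sub (ContinuousOn.mul (ContinuousOn.rpow_const (by fun_prop) ?_)
      (by fun_prop)) (by fun_prop)
    intro y hy
    exact Or.inl (by have := hze y hy; positivity)
  have hcpt : IsCompact (closure Ω) := hb.isCompact_closure
  obtain ⟨x₁, hx₁, hmax⟩ := hcpt.exists_isMaxOn ⟨x, subset_closure hx⟩
    (huc.div hwc fun y hy => (hwx y hy).1.ne)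
  set s := u x₁ / w x₁ with hs
  have hle : ∀ y ∈ closure Ω, s * w y ≤ u y := by
    intro y hy
    have h1 : u y / w y ≤ s := hmax hy
    rwa [div_le_iff_of_neg (hwx y hy).1] at h1
  have hxw := hwx x (subset_closure hx)
  have hxs := hle x (subset_closure hx)
  have hneg' := hneg x hx
  suffices hs_le : s ≤ m * (K * C ^ q) ^ ((n - q)⁻¹) by
    have h0 : 0 ≤ inner ℝ e (x - z) + δ := by
      have := hze x (subset_closure hx); positivity
    calc |u x| = -u x := abs_of_nonpos hneg'
      _ ≤ s * (-w x) := by linarith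
      _ ≤ (m * (K * C ^ q) ^ ((n - q)⁻¹)) * (-w x) := by
          gcongr; linarith [hxw.1]
      _ = (m * (K * C ^ q) ^ ((n - q)⁻¹)) * |w x| := by rw [abs_of_neg hxw.1]
      _ ≤ (m * (K * C ^ q) ^ ((n - q)⁻¹)) * (C * (inner ℝ e (x - z) + δ)) := by
          gcongr; exact hxw.2
      _ = _ := by ring
  rcases le_or_gt s 0 with hs0 | hs0
  · exact hs0.trans (by positivity)
  have hx₁Ω : x₁ ∈ Ω := by
    by_contra hcon
    have : u x₁ = 0 := hu0 x₁ ⟨hx₁, by rwa [hΩ.interior_eq]⟩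
    rw [hs, this, zero_div] at hs0
    exact lt_irrefl _ hs0
  have hux₁ : u x₁ = s * w x₁ := by
    rw [hs, div_mul_cancel₀ _ (hwx x₁ hx₁).1.ne]
  set t := inner ℝ e (x₁ - z) + δ with ht
  have ht0 : 0 < t := by have := hze x₁ hx₁; positivity
  have hd := hu.differentiableAt_fderiv hΩ hx₁Ω
  have hlow : (s * t ^ γ) ^ n * (1 + (t ^ 2)⁻¹) ≤ hessianDet u x₁ := by
    refine Matrix.det_ge_of_rankOne_le_quadForm (hessianMatrix_isHermitian hΩ hu hx₁Ω)
      (e := WithLp.ofLp e) ?_ (by positivity) (by positivity) fun v => ?_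
    · have h2 : inner ℝ e e = (1 : ℝ) := by rw [real_inner_self_eq_norm_sq, he, one_pow]
      rw [EuclideanSpace.inner_eq_star_dotProduct] at h2
      simpa using h2
    · obtain ⟨f', d, hf, hf', hfd⟩ := exists_second_deriv_halfSpaceBarrier (C := C) hγ hN
        (hzD x₁ hx₁) ht0 (WithLp.toLp 2 v)
      have hloc : IsLocalMin (fun r : ℝ => u (x₁ + r • WithLp.toLp 2 v)
          - s * halfSpaceBarrier e z δ γ N C (x₁ + r • WithLp.toLp 2 v)) 0 := by
        have hcont : ContinuousAt (fun r : ℝ => x₁ + r • WithLp.toLp 2 v) 0 := by fun_prop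
        have hΩ' : Ω ∈ nhds (x₁ + (0 : ℝ) • WithLp.toLp 2 v) := by
          simpa using hΩ.mem_nhds hx₁Ω
        filter_upwards [hcont.preimage_mem_nhds hΩ'] with r hr
        have h1 := hle _ (subset_closure hr)
        simp only [zero_smul, add_zero]
        rw [← hw, hux₁, sub_self]
        linarith
      have h3 := le_second_fderiv_of_touching_below hΩ hu hx₁Ω
        (hf.mono fun r hr => hr.const_mul s) (hf'.const_mul s) hloc
      rw [hessianMatrix_quadForm hd]
      refine le_trans ?_ h3
      have h4 : v ⬝ᵥ v = ‖WithLp.toLp 2 v‖ ^ 2 := by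
        rw [← real_inner_self_eq_norm_sq, EuclideanSpace.inner_eq_star_dotProduct]; simp
      have h5 : WithLp.ofLp e ⬝ᵥ v = inner ℝ e (WithLp.toLp 2 v) := by
        rw [EuclideanSpace.inner_eq_star_dotProduct]; simp [dotProduct_comm]
      rw [h4, h5, mul_assoc]
      gcongr
  have hup : hessianDet u x₁ ≤ K * m ^ (n - q) * (s * (C * t)) ^ q := by
    refine (hdet x₁ hx₁Ω).trans ?_
    gcongr
    rw [hux₁, abs_mul, abs_of_pos hs0]
    gcongr
    exact (hwx x₁ hx₁).2
  have hcomb : s ^ (n - q) ≤ m ^ (n - q) * (K * C ^ q) := by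
    have h1 : s ^ (n : ℝ) * t ^ q ≤ (s * t ^ γ) ^ n * (1 + (t ^ 2)⁻¹) := by
      have h2 : (t ^ γ) ^ n * (t ^ 2)⁻¹ = t ^ q := by
        rw [← rpow_natCast (t ^ γ), ← rpow_mul ht0.le, hγq, rpow_add ht0]
        norm_num
        field_simp
      rw [mul_pow, rpow_natCast, ← h2, mul_assoc]
      gcongr
      linarith
    have h2 := h1.trans (hlow.trans hup)
    rw [mul_rpow hs0.le (by positivity), mul_rpow hC0.le ht0.le] at h2
    have h3 : s ^ (n : ℝ) = s ^ ((n : ℝ) - q) * s ^ q := by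
      rw [← rpow_add hs0]; congr 1; ring
    have hs' : 0 < s ^ q := rpow_pos_of_pos hs0 q
    have ht' : 0 < t ^ q := rpow_pos_of_pos ht0 q
    have h4 : 0 < s ^ q * t ^ q := by positivity
    refine le_of_mul_le_mul_right ?_ h4
    rw [h3] at h2
    linarith
  have hnq : 0 < (n : ℝ) - q := by linarith
  calc s = (s ^ ((n : ℝ) - q)) ^ (((n : ℝ) - q)⁻¹) := (rpow_rpow_inv hs0.le hnq.ne').symm
    _ ≤ (m ^ ((n : ℝ) - q) * (K * C ^ q)) ^ (((n : ℝ) - q)⁻¹) := by gcongr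
    _ = m * (K * C ^ q) ^ (((n : ℝ) - q)⁻¹) := by
      rw [mul_rpow (by positivity) (by positivity), rpow_rpow_inv hm.le hnq.ne']

lemma ConvexOn.quadForm_hessianMatrix_nonneg (hΩ : IsOpen Ω) (hu : ContDiffOn ℝ 2 u Ω)
    (hc : ConvexOn ℝ Ω u) {x : EuclideanSpace ℝ (Fin n)} (hx : x ∈ Ω) (v : Fin n → ℝ) :
    0 ≤ v ⬝ᵥ ((hessianMatrix u x).mulVec v) := by
  rw [hessianMatrix_quadForm (hu.differentiableAt_fderiv hΩ hx)]
  exact hc.second_fderiv_nonneg hΩ hu hx _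

lemma ConvexOn.hessianDet_le_of_isLocalMax_sub (hΩ : IsOpen Ω) (hu : ContDiffOn ℝ 2 u Ω)
    (hc : ConvexOn ℝ Ω u) {x y : EuclideanSpace ℝ (Fin n)} (hx : x ∈ Ω) {l : ℝ}
    (hmax : IsLocalMax (fun ξ => u ξ - l / 2 * ‖ξ - y‖ ^ 2) x) : hessianDet u x ≤ l ^ n := by
  refine Matrix.det_le_pow_of_quadForm_le (hessianMatrix_isHermitian hΩ hu hx)
    (hc.quadForm_hessianMatrix_nonneg hΩ hu hx) fun v => ?_
  rw [hessianMatrix_quadForm (hu.differentiableAt_fderiv hΩ hx)]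
  have h4 : v ⬝ᵥ v = ‖WithLp.toLp 2 v‖ ^ 2 := by
    rw [← real_inner_self_eq_norm_sq, EuclideanSpace.inner_eq_star_dotProduct]; simp
  rw [h4]
  set ξ := WithLp.toLp 2 v
  have hloc : IsLocalMax (fun r : ℝ => u (x + r • ξ) - l / 2 * ‖x + r • ξ - y‖ ^ 2) 0 := by
    have hcont : ContinuousAt (fun r : ℝ => x + r • ξ) 0 := by fun_prop
    have hmax' : IsLocalMax (fun ξ => u ξ - l / 2 * ‖ξ - y‖ ^ 2) (x + (0 : ℝ) • ξ) := by
      simpa using hmax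
    exact hcont.eventually hmax'
  refine second_fderiv_le_of_touching_above hΩ hu hx
    (f' := fun r => l * (inner ℝ (x - y) ξ + ‖ξ‖ ^ 2 * r)) (.of_forall fun r => ?_) ?_ hloc
  · have hfun : (fun r : ℝ => l / 2 * ‖x + r • ξ - y‖ ^ 2) = fun r =>
        l / 2 * (‖x - y‖ ^ 2 + 2 * inner ℝ (x - y) ξ * r + ‖ξ‖ ^ 2 * r ^ 2) := by
      funext r
      have h1 : x + r • ξ - y = (x - y) + r • ξ := by abel
      rw [h1, norm_add_sq_real, real_inner_smul_right, norm_smul, mul_pow, Real.norm_eq_abs, sq_abs]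
      ring
    rw [hfun]
    have h1 := ((((hasDerivAt_id r).const_mul (2 * inner ℝ (x - y) ξ)).const_add
      (‖x - y‖ ^ 2)).add ((hasDerivAt_pow 2 r).const_mul (‖ξ‖ ^ 2))).const_mul (l / 2)
    refine h1.congr_deriv ?_
    simp; ring
  · simpa using (((hasDerivAt_id (0 : ℝ)).const_mul (‖ξ‖ ^ 2)).const_add
      (inner ℝ (x - y) ξ)).const_mul l

lemma nonpos_of_hessianDet_eq (hn : n ≠ 0) (hΩ : IsOpen Ω) (hb : Bornology.IsBounded Ω)
    (huc : ContinuousOn u (closure Ω)) (hu : ContDiffOn ℝ 2 u Ω) (hc : ConvexOn ℝ Ω u)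
    (hu0 : ∀ x ∈ frontier Ω, u x = 0) (hdet : ∀ x ∈ Ω, u x ≠ 0 → 0 < hessianDet u x)
    {x : EuclideanSpace ℝ (Fin n)} (hx : x ∈ Ω) : u x ≤ 0 := by
  obtain ⟨x₁, hx₁, hmax⟩ := hb.isCompact_closure.exists_isMaxOn ⟨x, subset_closure hx⟩ huc
  by_contra! hpos
  have hpos₁ : 0 < u x₁ := hpos.trans_le (hmax (subset_closure hx))
  have hx₁Ω : x₁ ∈ Ω := by
    by_contra hcon
    exact hpos₁.ne' (hu0 x₁ ⟨hx₁, by rwa [hΩ.interior_eq]⟩)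
  have h1 := hc.hessianDet_le_of_isLocalMax_sub hΩ hu hx₁Ω (y := x₁) (l := 0) (by
    filter_upwards [hΩ.mem_nhds hx₁Ω] with y hy
    simpa using hmax (subset_closure hy))
  rw [zero_pow hn] at h1
  exact absurd (hdet x₁ hx₁Ω hpos₁.ne') (not_lt.2 h1)

lemma mul_rpow_le_of_hessianDet_eq (hΩ : IsOpen Ω) (hu : ContDiffOn ℝ 2 u Ω)
    (hc : ConvexOn ℝ Ω u) {p M m r : ℝ} (hp : 0 < p) (hM : 0 < M) (hm : 0 < m) (hr : 0 < r)
    (hdet : ∀ x ∈ Ω, hessianDet u x = M * |u x| ^ p)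
    (hneg : ∀ x ∈ Ω, u x ≤ 0) (hmu : ∀ x ∈ Ω, -m ≤ u x)
    {x₀ y : EuclideanSpace ℝ (Fin n)} (hx₀ : x₀ ∈ Ω) (hux₀ : u x₀ = -m) (hy : ball y r ⊆ Ω) :
    M * (m / 2) ^ p ≤ (64 * m / r ^ 2) ^ n := by
  set x₁ := (1 / 2 : ℝ) • x₀ + (1 / 2 : ℝ) • y with hx₁
  have hball : ∀ x ∈ closedBall x₁ (r / 4), x ∈ Ω ∧ u x ≤ -(m / 2) := by
    intro x hx
    have hy' : y + (2 : ℝ) • (x - x₁) ∈ Ω := by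
      apply hy
      rw [mem_ball, dist_eq_norm, add_sub_cancel_left, norm_smul]
      rw [mem_closedBall, dist_eq_norm] at hx
      norm_num
      linarith
    have hxe : x = (1 / 2 : ℝ) • x₀ + (1 / 2 : ℝ) • (y + (2 : ℝ) • (x - x₁)) := by
      rw [smul_add, smul_smul, ← add_assoc, ← hx₁]; norm_num
    have h1 := hc.1 hx₀ hy'
      (show (0 : ℝ) ≤ 1 / 2 by norm_num) (show (0 : ℝ) ≤ 1 / 2 by norm_num) (by norm_num)
    have h2 := hc.2 hx₀ hy'
      (show (0 : ℝ) ≤ 1 / 2 by norm_num) (show (0 : ℝ) ≤ 1 / 2 by norm_num) (by norm_num)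
    rw [← hxe] at h1 h2
    refine ⟨h1, h2.trans ?_⟩
    have := hneg _ hy'
    rw [hux₀, smul_eq_mul, smul_eq_mul]
    linarith
  have hxc : x₁ ∈ closedBall x₁ (r / 4) := mem_closedBall_self (by positivity)
  set l := 64 * m / r ^ 2 with hl
  have hlr : l / 2 * (r / 4) ^ 2 = 2 * m := by rw [hl]; field_simp; norm_num
  obtain ⟨x₂, hx₂, hmax⟩ := (isCompact_closedBall x₁ (r / 4)).exists_isMaxOn ⟨x₁, hxc⟩
    (f := fun ξ => u ξ - l / 2 * ‖ξ - x₁‖ ^ 2)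
    ((hu.continuousOn.mono fun x hx => (hball x hx).1).sub (by fun_prop))
  obtain ⟨hx₂Ω, hux₂⟩ := hball x₂ hx₂
  have hlt : dist x₂ x₁ < r / 4 := by
    refine lt_of_le_of_ne hx₂ fun heq => ?_
    have h1 : u x₁ - l / 2 * ‖x₁ - x₁‖ ^ 2 ≤ u x₂ - l / 2 * ‖x₂ - x₁‖ ^ 2 := hmax hxc
    rw [← dist_eq_norm x₂, heq, hlr] at h1
    have h2 := hmu x₁ (hball x₁ hxc).1
    simp at h1
    linarith
  have h1 := hc.hessianDet_le_of_isLocalMax_sub hΩ hu hx₂Ω (y := x₁) (l := l) (by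
    filter_upwards [isOpen_ball.mem_nhds hlt] with ξ hξ
    exact hmax (ball_subset_closedBall hξ))
  rw [hdet x₂ hx₂Ω] at h1
  refine le_trans ?_ h1
  gcongr
  rw [abs_of_nonpos (by linarith)]
  linarith

lemma ConvexOn.norm_fderiv_le_of_halfSpace_bound (hΩ : IsOpen Ω) (hb : Bornology.IsBounded Ω)
    (hu : ContDiffOn ℝ 2 u Ω) (hc : ConvexOn ℝ Ω u) (hneg : ∀ x ∈ Ω, u x ≤ 0) {L : ℝ} (hL : 0 ≤ L)
    (hbd : ∀ z ∈ frontier Ω, ∀ e : EuclideanSpace ℝ (Fin n), ‖e‖ = 1 →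
      (∀ x ∈ closure Ω, 0 ≤ inner ℝ e (x - z)) → ∀ x ∈ Ω, |u x| ≤ L * inner ℝ e (x - z))
    {x : EuclideanSpace ℝ (Fin n)} (hx : x ∈ Ω) : ‖fderiv ℝ u x‖ ≤ L := by
  have hdir : ∀ h : EuclideanSpace ℝ (Fin n), ‖h‖ = 1 → fderiv ℝ u x h ≤ L := by
    intro h hh
    obtain ⟨T, hT, hz⟩ : ∃ T : ℝ, 0 ≤ T ∧ x + T • h ∈ frontier Ω := by
      have hpre : IsPreconnected ((fun r : ℝ => x + r • h) '' Set.Ici 0) :=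
        isPreconnected_Ici.image _ (by fun_prop)
      obtain ⟨R, hR⟩ := hb.closure.subset_closedBall x
      by_contra! hcon
      obtain ⟨y, -, hy, hy'⟩ := hpre Ω (closure Ω)ᶜ hΩ isClosed_closure.isOpen_compl
        (by
          rintro _ ⟨r, hr, rfl⟩
          by_contra hmem
          rw [Set.mem_union, not_or, Set.notMem_compl_iff] at hmem
          exact hcon r hr ⟨hmem.2, by rw [hΩ.interior_eq]; exact hmem.1⟩)
        ⟨x, ⟨0, by simp, by simp⟩, hx⟩
        ⟨x + (|R| + 1) • h, ⟨|R| + 1, by simp; positivity, rfl⟩, fun hmem => by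
          have h1 := hR hmem
          rw [mem_closedBall, dist_eq_norm, add_sub_cancel_left, norm_smul, hh, mul_one,
            Real.norm_of_nonneg (by positivity)] at h1
          linarith [le_abs_self R]⟩
      exact hy' (subset_closure hy)
    set z := x + T • h with hzdef
    have hzΩ : z ∉ Ω := fun hcon => hz.2 (by rwa [hΩ.interior_eq])
    have hT0 : 0 < T := by
      refine lt_of_le_of_ne hT fun h0 => hzΩ ?_
      rw [hzdef, ← h0]; simpa using hx
    obtain ⟨f, hf⟩ := geometric_hahn_banach_open_point hc.1 hΩ hzΩ
    set a := (InnerProductSpace.toDual ℝ (EuclideanSpace ℝ (Fin n))).symm f with ha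
    have hfa : ∀ y, f y = inner ℝ a y := fun y => by
      rw [ha, InnerProductSpace.toDual_symm_apply]
    have ha0 : 0 < ‖a‖ := by
      rw [norm_pos_iff]
      intro h0
      have := hf x hx
      simp [hfa, h0] at this
    have hsupp : ∀ y ∈ Ω, 0 ≤ inner ℝ (-(‖a‖⁻¹ • a)) (y - z) := by
      intro y hy
      have h1 := hf y hy
      rw [hfa, hfa] at h1
      rw [inner_neg_left, real_inner_smul_left, inner_sub_right]
      have : 0 < ‖a‖⁻¹ := by positivity
      nlinarith
    have he : ‖-(‖a‖⁻¹ • a)‖ = 1 := by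
      rw [norm_neg, norm_smul, norm_inv, norm_norm, inv_mul_cancel₀ ha0.ne']
    have hcl : closure Ω ⊆ {y | 0 ≤ inner ℝ (-(‖a‖⁻¹ • a)) (y - z)} :=
      closure_minimal hsupp (isClosed_le (by fun_prop) (by fun_prop))
    have hux := hbd z hz _ he (fun y hy => hcl hy) x hx
    have hxz : inner ℝ (-(‖a‖⁻¹ • a)) (x - z) ≤ T := by
      refine (real_inner_le_norm _ _).trans (le_of_eq ?_)
      rw [he, one_mul, hzdef, norm_sub_rev, add_sub_cancel_left, norm_smul, hh, mul_one,
        Real.norm_of_nonneg hT]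
    have huT : |u x| ≤ L * T := hux.trans (by gcongr)
    have hslope : ∀ r : ℝ, 0 < r → r < T → r * fderiv ℝ u x h ≤ L * T := by
      intro r hr hrT
      have hmem : x + r • h ∈ Ω := by
        have hseg := hc.1.openSegment_interior_closure_subset_interior
          (x := x) (y := z) (by rwa [hΩ.interior_eq]) hz.1
        rw [hΩ.interior_eq, openSegment_eq_image'] at hseg
        refine hseg ⟨r / T, ⟨by positivity, (div_lt_one hT0).2 hrT⟩, ?_⟩
        simp [hzdef, smul_smul, div_mul_cancel₀ _ hT0.ne']
      have h1 := hc.fderiv_apply_sub_le ((hu.differentiableOn (by norm_num)).differentiableAt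
        (hΩ.mem_nhds hx)) hx hmem
      rw [add_sub_cancel_left, map_smul, smul_eq_mul] at h1
      linarith [hneg _ hmem, neg_abs_le (u x)]
    by_contra! hcon
    have hg : 0 < fderiv ℝ u x h := hL.trans_lt hcon
    have hlt : L * T / fderiv ℝ u x h < T := by
      rw [div_lt_iff₀ hg]; nlinarith
    obtain ⟨r, hr1, hr2⟩ := exists_between hlt
    have hr0 : 0 < r := lt_of_le_of_lt (by positivity) hr1
    rw [div_lt_iff₀ hg] at hr1
    linarith [hslope r hr0 hr2]
  refine ContinuousLinearMap.opNorm_le_of_unit_norm hL fun h hh => ?_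
  rw [Real.norm_eq_abs, abs_le]
  have h1 := hdir (-h) (by rwa [norm_neg])
  rw [map_neg] at h1
  exact ⟨by linarith, hdir h hh⟩

end Estimates

section Inradius

variable {n : ℕ}

lemma EuclideanSpace.eq_sum_det_updateRow_smul {A : Matrix (Fin n) (Fin n) ℝ} (hA : A.det ≠ 0)
    (ζ : EuclideanSpace ℝ (Fin n)) :
    ζ = ∑ i, ((A.updateRow i ζ).det / A.det) • WithLp.toLp 2 (A i) := by
  have h := Matrix.mulVec_cramer A.transpose (WithLp.ofLp ζ)
  rw [Matrix.det_transpose] at h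
  ext j
  have hj := congrFun h j
  simp only [Matrix.mulVec, dotProduct, Matrix.transpose_apply, Matrix.cramer_transpose_apply,
    Pi.smul_apply, smul_eq_mul] at hj
  simp only [WithLp.ofLp_sum, Finset.sum_apply, WithLp.ofLp_smul, Pi.smul_apply, smul_eq_mul]
  rw [eq_comm, ← mul_right_inj' hA, ← hj, Finset.mul_sum]
  refine Finset.sum_congr rfl fun i _ => ?_
  field_simp

lemma Convex.add_sum_smul_sub_mem {ι E : Type*} [Fintype ι] [AddCommGroup E] [Module ℝ E]
    {s : Set E} (hs : Convex ℝ s) {x₀ : E} {X : ι → E} {w : ι → ℝ} (hx₀ : x₀ ∈ s)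
    (hX : ∀ i, X i ∈ s) (hw : ∀ i, 0 ≤ w i) (hw1 : ∑ i, w i ≤ 1) :
    x₀ + ∑ i, w i • (X i - x₀) ∈ s := by
  have h := hs.sum_mem (t := Finset.univ) (w := fun o : Option ι => o.elim (1 - ∑ i, w i) w)
    (z := fun o => o.elim x₀ X) ?_ ?_ ?_
  · convert h using 1
    simp only [Fintype.sum_option, Option.elim, smul_sub, Finset.sum_sub_distrib, sub_smul,
      one_smul, Finset.sum_smul]
    abel
  · rintro (_ | i) - <;> simp [hw1, hw]
  · simp [Fintype.sum_option]
  · rintro (_ | i) - <;> simp [hx₀, hX]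

/-- A bounded convex set contains points spanning a simplex whose determinant controls that of
any other simplex with the same apex. -/
lemma exists_maximal_simplex {Ω : Set (EuclideanSpace ℝ (Fin n))} (hΩ : IsOpen Ω)
    (hb : Bornology.IsBounded Ω) {x₀ : EuclideanSpace ℝ (Fin n)} (hx₀ : x₀ ∈ Ω) :
    ∃ X : Fin n → EuclideanSpace ℝ (Fin n), (∀ i, X i ∈ closure Ω) ∧
      (Matrix.of fun i j => (X i - x₀) j).det ≠ 0 ∧
      ∀ i, ∀ y ∈ closure Ω, |((Matrix.of fun i j => (X i - x₀) j).updateRow i (y - x₀)).det| ≤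
        |(Matrix.of fun i j => (X i - x₀) j).det| := by
  set F : (Fin n → EuclideanSpace ℝ (Fin n)) → ℝ :=
    fun X => |(Matrix.of fun i j => (X i - x₀) j).det| with hF
  have hFc : Continuous F := by
    refine continuous_abs.comp (Continuous.matrix_det ?_)
    refine continuous_matrix fun i j => ?_
    simp only [Matrix.of_apply]
    fun_prop
  obtain ⟨X, hX, hmax⟩ := (isCompact_univ_pi fun _ : Fin n => hb.isCompact_closure).exists_isMaxOn
    ⟨fun _ => x₀, fun _ _ => subset_closure hx₀⟩ hFc.continuousOn
  refine ⟨X, fun i => hX i trivial, ?_, fun i y hy => ?_⟩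
  · obtain ⟨ρ, hρ, hball⟩ := Metric.isOpen_iff.1 hΩ x₀ hx₀
    have h1 : F (fun i => x₀ + EuclideanSpace.single i (ρ / 2)) ≤ F X := by
      refine hmax fun i _ => subset_closure (hball ?_)
      rw [mem_ball, dist_eq_norm, add_sub_cancel_left, PiLp.norm_single,
        Real.norm_of_nonneg (by positivity)]
      linarith
    have h2 : (Matrix.of fun i j : Fin n =>
        (x₀ + EuclideanSpace.single i (ρ / 2) - x₀) j) = (ρ / 2) • 1 := by
      ext i j
      simp [Matrix.one_apply, eq_comm]
    have h3 : 0 < F (fun i => x₀ + EuclideanSpace.single i (ρ / 2)) := by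
      simp only [hF, h2, Matrix.det_smul, Matrix.det_one, mul_one]
      positivity
    exact abs_pos.1 (h3.trans_le h1)
  · have h1 : F (Function.update X i y) ≤ F X := by
      refine hmax fun k _ => ?_
      rcases eq_or_ne k i with rfl | hk
      · simpa using hy
      · simpa [hk] using hX k trivial
    refine le_trans (le_of_eq ?_) h1
    simp only [hF]
    congr 2
    ext k j
    rcases eq_or_ne k i with rfl | hk
    · simp
    · simp [hk]

lemma exists_ball_subset_of_volume_of_diam (hn : n ≠ 0) {V D : ℝ} (hV : 0 < V) (hD : 0 < D) :
    ∃ r : ℝ, 0 < r ∧ ∀ Ω : Set (EuclideanSpace ℝ (Fin n)), IsOpen Ω → Bornology.IsBounded Ω →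
      Convex ℝ Ω → volume Ω = ENNReal.ofReal V → Metric.diam Ω = D → ∃ y, ball y r ⊆ Ω := by
  set S : Set (EuclideanSpace ℝ (Fin n)) := {c | ∀ i, |c i| ≤ 1} with hS
  have hSb : Bornology.IsBounded S := by
    refine (isBounded_closedBall (x := (0 : EuclideanSpace ℝ (Fin n))) (r := √n)).subset ?_
    intro c hc
    rw [mem_closedBall_zero_iff, EuclideanSpace.norm_eq]
    refine Real.sqrt_le_sqrt ?_
    calc ∑ i, ‖c i‖ ^ 2 ≤ ∑ _i : Fin n, (1 : ℝ) :=
          Finset.sum_le_sum fun i _ => by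
            rw [Real.norm_eq_abs]; exact pow_le_one₀ (abs_nonneg _) (hc i)
      _ = n := by simp
  set κ := (volume S).toReal with hκ
  have hκ0 : 0 ≤ κ := ENNReal.toReal_nonneg
  set B : ℝ := n.factorial * (max D 1) ^ n with hB
  have hB0 : 0 < B := by positivity
  have hn0 : (0 : ℝ) < n := by exact_mod_cast Nat.pos_of_ne_zero hn
  set r : ℝ := V / ((κ + 1) * B * (2 * n)) with hr
  have hr0 : 0 < r := by positivity
  refine ⟨r, hr0, fun Ω hΩ hb hc hvol hdiam => ?_⟩
  obtain ⟨x₀, hx₀⟩ : Ω.Nonempty := by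
    by_contra hcon
    rw [Set.not_nonempty_iff_eq_empty] at hcon
    rw [hcon, measure_empty, eq_comm, ENNReal.ofReal_eq_zero] at hvol
    linarith
  obtain ⟨X, hX, hdet, hmax⟩ := exists_maximal_simplex hΩ hb hx₀
  set A : Matrix (Fin n) (Fin n) ℝ := Matrix.of fun i j => (X i - x₀) j with hA
  have hAi : ∀ i, WithLp.toLp 2 (A i) = X i - x₀ := fun i => rfl
  have hdet0 : 0 < |A.det| := abs_pos.2 hdet
  have hvolA : V ≤ |A.det| * (κ + 1) := by
    have hsub : Ω ⊆ (fun y => y + -x₀) ⁻¹' (Matrix.toEuclideanLin A.transpose '' S) := by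
      intro y hy
      refine ⟨WithLp.toLp 2 fun i => (A.updateRow i (y - x₀)).det / A.det, fun i => ?_, ?_⟩
      · rw [PiLp.toLp_apply, abs_div, div_le_one hdet0]
        exact hmax i y (subset_closure hy)
      · change _ = y + -x₀
        rw [← sub_eq_add_neg]
        conv_rhs => rw [EuclideanSpace.eq_sum_det_updateRow_smul hdet (y - x₀)]
        ext j
        simp [Matrix.toLpLin_apply, Matrix.mulVec, dotProduct, mul_comm]
    have h1 := measure_mono (μ := volume) hsub
    rw [measure_preimage_add_right, Measure.addHaar_image_linearMap, hvol, LinearMap.det_toLpLin,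
      Matrix.det_transpose] at h1
    have hfin : volume S ≠ ⊤ := hSb.measure_lt_top.ne
    rw [← ENNReal.ofReal_toReal hfin, ← ENNReal.ofReal_mul (abs_nonneg _),
      ENNReal.ofReal_le_ofReal_iff (by positivity)] at h1
    linarith
  have hAij : ∀ i j, |A i j| ≤ D := by
    intro i j
    calc |A i j| = ‖(X i - x₀) j‖ := rfl
      _ ≤ ‖X i - x₀‖ := PiLp.norm_apply_le _ _
      _ = dist (X i) x₀ := (dist_eq_norm _ _).symm
      _ ≤ Metric.diam (closure Ω) := dist_le_diam_of_mem hb.closure (hX i) (subset_closure hx₀)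
      _ = D := by rw [Metric.diam_closure, hdiam]
  have hcoef : ∀ ζ : EuclideanSpace ℝ (Fin n), ‖ζ‖ ≤ r → ∀ i,
      |(A.updateRow i ζ).det / A.det| ≤ 1 / (2 * n) := by
    intro ζ hζ i
    have hζ' : WithLp.ofLp ζ = r • (r⁻¹ • WithLp.ofLp ζ) := by
      rw [smul_smul, mul_inv_cancel₀ hr0.ne', one_smul]
    have h1 : |(A.updateRow i (r⁻¹ • WithLp.ofLp ζ)).det| ≤ B := by
      have h2 := Matrix.det_le (A := A.updateRow i (r⁻¹ • WithLp.ofLp ζ))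
        (abv := AbsoluteValue.abs) (x := max D 1) (fun k j => by
          rw [AbsoluteValue.abs_apply, Matrix.updateRow_apply]
          split_ifs
          · refine le_max_of_le_right ?_
            rw [Pi.smul_apply, smul_eq_mul, abs_mul, abs_of_pos (inv_pos.2 hr0),
              inv_mul_le_iff₀ hr0, mul_one]
            exact (PiLp.norm_apply_le ζ j).trans hζ
          · exact le_max_of_le_left (hAij k j))
      simpa [hB] using h2
    rw [hζ', Matrix.det_updateRow_smul, abs_div, abs_mul, abs_of_pos hr0, div_le_iff₀ hdet0]
    calc r * |(A.updateRow i (r⁻¹ • WithLp.ofLp ζ)).det| ≤ r * B := by gcongr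
      _ = 1 / (2 * n) * (V / (κ + 1)) := by rw [hr]; field_simp
      _ ≤ 1 / (2 * n) * |A.det| := by
        gcongr
        rwa [div_le_iff₀ (by positivity)]
  have hball : ball (x₀ + ∑ i, (1 / (2 * n) : ℝ) • (X i - x₀)) r ⊆ closure Ω := by
    intro y hy
    rw [mem_ball, dist_eq_norm] at hy
    set ζ := y - (x₀ + ∑ i, (1 / (2 * n) : ℝ) • (X i - x₀)) with hζ
    have hyeq : y = x₀ + ∑ i, ((1 / (2 * n) : ℝ) + (A.updateRow i ζ).det / A.det) • (X i - x₀) := by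
      have h1 := EuclideanSpace.eq_sum_det_updateRow_smul hdet ζ
      simp only [hAi] at h1
      simp only [add_smul, Finset.sum_add_distrib]
      rw [← add_assoc, ← h1, hζ, add_sub_cancel]
    rw [hyeq]
    have hco := hcoef ζ hy.le
    refine hc.closure.add_sum_smul_sub_mem (subset_closure hx₀) hX (fun i => ?_) ?_
    · linarith [(abs_le.1 (hco i)).1]
    · calc ∑ i, ((1 / (2 * n) : ℝ) + (A.updateRow i ζ).det / A.det) ≤ ∑ _i : Fin n, (1 / n : ℝ) := by
            refine Finset.sum_le_sum fun i _ => ?_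
            have := (abs_le.1 (hco i)).2
            have h2 : (1 / n : ℝ) = 1 / (2 * n) + 1 / (2 * n) := by field_simp; norm_num
            linarith
        _ = 1 := by simp; field_simp
  refine ⟨x₀ + ∑ i, (1 / (2 * n) : ℝ) • (X i - x₀), fun y hy => ?_⟩
  have h1 := interior_maximal hball isOpen_ball hy
  rwa [hc.interior_closure_eq_interior_of_nonempty_interior
    (by rw [hΩ.interior_eq]; exact ⟨x₀, hx₀⟩), hΩ.interior_eq] at h1

end Inradius

/-- Global gradient bound for the Monge–Ampère eigenfunctions and
solutions of `det D²u = M|u|^p`, `p > n-2`: `sup_Ω |Du| ≤ C sup_Ω |u|`. -/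
theorem stmt_18 (n : ℕ) (hn : 2 ≤ n) (p M V D : ℝ)
    (hp : (n : ℝ) - 2 < p) (hM : 0 < M) (hV : 0 < V) (hD : 0 < D) :
    ∃ C : ℝ, 0 < C ∧
      ∀ (Ω : Set (EuclideanSpace ℝ (Fin n))) (u : EuclideanSpace ℝ (Fin n) → ℝ),
        IsOpen Ω → Bornology.IsBounded Ω → Convex ℝ Ω →
        volume Ω = ENNReal.ofReal V → Metric.diam Ω = D →
        ContinuousOn u (closure Ω) → ContDiffOn ℝ 1 u Ω → ContDiffOn ℝ 2 u Ω →
        ConvexOn ℝ Ω u →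
        (∃ x ∈ Ω, u x ≠ 0) →
        (∀ x ∈ Ω, hessianDet u x = M * |u x| ^ p) →
        (∀ x ∈ frontier Ω, u x = 0) →
        ∀ x ∈ Ω, ‖fderiv ℝ u x‖ ≤ C * sSup ((fun y => |u y|) '' Ω) := by
  have hn' : (2 : ℝ) ≤ n := by exact_mod_cast hn
  have hn0 : (0 : ℝ) < n := by linarith
  have hnz : n ≠ 0 := by lia
  have hp0 : 0 < p := by linarith
  obtain ⟨r, hr, hball⟩ := exists_ball_subset_of_volume_of_diam hnz hV hD
  obtain ⟨q, hqp, hqn, hq2, hq0⟩ : ∃ q : ℝ, q ≤ p ∧ q < n ∧ (n : ℝ) - 2 < q ∧ 0 < q :=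
    ⟨min p (n - 1), min_le_left _ _, (min_le_right _ _).trans_lt (by linarith),
      lt_min hp (by linarith), lt_min hp0 (by linarith)⟩
  obtain ⟨γ, hγq, hγ⟩ : ∃ γ : ℝ, γ * n = q + 2 ∧ 1 < γ :=
    ⟨(q + 2) / n, by field_simp, by rw [lt_div_iff₀ hn0]; linarith⟩
  have hγ' : 0 < γ * (γ - 1) := by nlinarith
  obtain ⟨N, hN, hN0⟩ : ∃ N : ℝ, γ * (γ - 1) * N = 4 * γ ^ 2 * D ^ 2 + 1 ∧ 0 < N :=
    ⟨(4 * γ ^ 2 * D ^ 2 + 1) / (γ * (γ - 1)), mul_div_cancel₀ _ hγ'.ne', by positivity⟩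
  obtain ⟨C, hC⟩ : ∃ C : ℝ, C = (2 * D) ^ (γ - 1) * (D ^ 2 + N) + 1 := ⟨_, rfl⟩
  have hC0 : 0 < C := by rw [hC]; positivity
  set K : ℝ := 2 ^ p * (64 / r ^ 2) ^ n with hK
  have hK0 : 0 < K := by positivity
  refine ⟨(K * C ^ q) ^ (((n : ℝ) - q)⁻¹) * C, by positivity, ?_⟩
  intro Ω u hΩ hb hc hvol hdiam huc _ hu hcx hne hdet hu0 x hx
  obtain ⟨y, hy⟩ := hball Ω hΩ hb hc hvol hdiam
  set m := sSup ((fun y => |u y|) '' Ω) with hm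
  obtain ⟨ξ, hξ, hξ0⟩ := hne
  obtain ⟨x₀, hx₀, hmax⟩ := hb.isCompact_closure.exists_isMaxOn ⟨x, subset_closure hx⟩ huc.abs
  have hmax' : ∀ y ∈ Ω, |u y| ≤ |u x₀| := fun y hy => hmax (subset_closure hy)
  have hux₀ : 0 < |u x₀| := (abs_pos.2 hξ0).trans_le (hmax' ξ hξ)
  have hx₀Ω : x₀ ∈ Ω := by
    by_contra hcon
    exact abs_pos.1 hux₀ (hu0 x₀ ⟨hx₀, by rwa [hΩ.interior_eq]⟩)
  have hmeq : m = |u x₀| :=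
    IsGreatest.csSup_eq ⟨⟨x₀, hx₀Ω, rfl⟩, by rintro _ ⟨y, hy, rfl⟩; exact hmax' y hy⟩
  have hm0 : 0 < m := hmeq ▸ hux₀
  have hum : ∀ y ∈ Ω, |u y| ≤ m := fun y hy => hmeq ▸ hmax' y hy
  have hneg : ∀ y ∈ Ω, u y ≤ 0 := fun y hy =>
    nonpos_of_hessianDet_eq hnz hΩ hb huc hu hcx hu0 (fun y hy h0 => by
      rw [hdet y hy]
      have := abs_pos.2 h0
      positivity) hy
  have hMK : M * m ^ p ≤ K * m ^ n := by
    have h1 := mul_rpow_le_of_hessianDet_eq hΩ hu hcx hp0 hM hm0 hr hdet hneg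
      (fun y hy => by linarith [hum y hy, neg_abs_le (u y)]) hx₀Ω
      (by rw [hmeq, abs_of_nonpos (hneg x₀ hx₀Ω), neg_neg]) hy
    rw [div_rpow hm0.le (by norm_num), mul_div_right_comm, mul_pow] at h1
    calc M * m ^ p = 2 ^ p * (M * (m ^ p / 2 ^ p)) := by field_simp
      _ ≤ 2 ^ p * ((64 / r ^ 2) ^ n * m ^ n) := by gcongr
      _ = K * m ^ n := by rw [hK]; ring
  have hdet' : ∀ y ∈ Ω, hessianDet u y ≤ K * m ^ ((n : ℝ) - q) * |u y| ^ q := by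
    intro y hy
    rw [hdet y hy]
    have h1 : |u y| ^ p ≤ m ^ (p - q) * |u y| ^ q := by
      have h2 : |u y| ^ p = |u y| ^ (p - q) * |u y| ^ q := by
        rw [← rpow_add_of_nonneg (abs_nonneg _) (by linarith) hq0.le, sub_add_cancel]
      rw [h2]
      gcongr
      exact hum y hy
    have h3 : M * m ^ (p - q) ≤ K * m ^ ((n : ℝ) - q) := by
      rw [rpow_sub hm0, rpow_sub hm0, rpow_natCast, ← mul_div_assoc, ← mul_div_assoc]
      gcongr
    calc M * |u y| ^ p ≤ M * (m ^ (p - q) * |u y| ^ q) := by gcongr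
      _ = M * m ^ (p - q) * |u y| ^ q := by ring
      _ ≤ _ := by gcongr
  refine hcx.norm_fderiv_le_of_halfSpace_bound hΩ hb hu hneg (by positivity) ?_ hx
  intro z hz e he hze y hy
  have hzD : ∀ x ∈ closure Ω, ‖x - z‖ ≤ D := by
    intro x hx
    rw [← dist_eq_norm, ← hdiam, ← Metric.diam_closure]
    exact dist_le_diam_of_mem hb.closure hx hz.1
  set L := (K * C ^ q) ^ (((n : ℝ) - q)⁻¹) * C * m with hL
  have hL0 : 0 < L := by positivity
  refine le_of_forall_pos_le_add fun ε hε => ?_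
  have h1 := abs_le_mul_height_of_hessianDet_le hΩ hb huc hu hu0 hneg he hD hze hzD hqn hγ hγq hN hC
    hK0.le hm0 hdet' hq0 (δ := min D (ε / L)) (by positivity) (min_le_left _ _) hy
  calc |u y| ≤ L * (inner ℝ e (y - z) + min D (ε / L)) := h1.trans_eq (by rw [hL]; ring)
    _ ≤ L * (inner ℝ e (y - z) + ε / L) := by gcongr; exact min_le_right _ _
    _ = L * inner ℝ e (y - z) + ε := by field_simp
end
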